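/- arXiv:2104.06966 — 2 statements merged into one kernel-verified Lean document; each statement's English description precedes it below -/
import Mathlib

section
/- Let a ∈ (ℤ\{0})⁴ and let C ≥ 1 be real. Then for every ε > 0, Σ Δ_c(a)^{3/8} ≪_ε C³·|A|^ε·Δ(a)^{1/2}, where the sum is over all nonzero c ∈ ℤ⁴ satisfying |c_i| ≤ C·|a_i|^{1/2} for all i and F*_a(c) = 0, A = a₁a₂a₃a₄, and the implied constant depends only on ε. -/
open scoped BigOperators
open MeasureTheory Filter

attribute [local instance 0] Classical.propDecidable

noncomputable section

/-- `e(t) = exp(2πit)`. -/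
def eC (t : ℝ) : ℂ := Complex.exp (2 * Real.pi * Complex.I * t)

/-- A nonzero integer `z` is squareful if `p² ∣ z` for every prime `p` dividing `z`. -/
def Squareful (z : ℤ) : Prop := ∀ p : ℕ, p.Prime → (p : ℤ) ∣ z → (p : ℤ) ^ 2 ∣ z

/-- The standard bump function in one variable. -/
def psi1 (t : ℝ) : ℝ := if |t| < 1 then Real.exp (-(1 - t ^ 2)⁻¹) else 0

/-- The smooth weight `w₁`. -/
def w1 (η : ℝ) (x : Fin 4 → ℝ) : ℝ :=
  if ‖x‖ ≤ η then 0
  else if ‖x‖ ≤ 2 * η then Real.exp 1 * psi1 (‖x‖ / η - 2)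
  else if ‖x‖ ≤ 1 - η then 1
  else if ‖x‖ ≤ 1 then Real.exp 1 * psi1 (‖x‖ / η - (1 - η) / η)
  else 0

/-- The smooth weight `w₂`. -/
def w2 (η : ℝ) (x : Fin 4 → ℝ) : ℝ :=
  if ‖x‖ ≤ η then 0
  else if ‖x‖ ≤ 2 * η then Real.exp 1 * psi1 (‖x‖ / η - 2)
  else if ‖x‖ ≤ 1 then 1
  else if ‖x‖ ≤ 1 + η then Real.exp 1 * psi1 (‖x‖ / η - 1 / η)
  else 0

/-- `u(t) = c₀ ψ₁(4t - 3)`, normalised so that `∫ u = 1`. -/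
def uFn (t : ℝ) : ℝ := (∫ s : ℝ, psi1 (4 * s - 3))⁻¹ * psi1 (4 * t - 3)

/-- Heath-Brown's function `h(x, y)`. -/
def hFn (x y : ℝ) : ℝ :=
  ∑' j : ℕ, (x * ((j : ℝ) + 1))⁻¹ *
    (uFn (x * ((j : ℝ) + 1)) - uFn (|y| / (x * ((j : ℝ) + 1))))

/-- The exponential sum `S_{q,a}(c)`. -/
def Sqa (a c : Fin 4 → ℤ) (q : ℕ) : ℂ :=
  ∑ k ∈ (Finset.range q).filter fun k => Nat.gcd k q = 1,
    ∑ b ∈ Fintype.piFinset fun _ : Fin 4 => Finset.range q,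
      eC (((((k : ℤ) * (∑ i, a i * (b i : ℤ) ^ 2) + ∑ i, (b i : ℤ) * c i) : ℤ) : ℝ) / (q : ℝ))

/-- Partial sums of the singular series `𝔊_a`. -/
def singularPartial (a : Fin 4 → ℤ) (T : ℕ) : ℂ :=
  ∑ q ∈ Finset.Icc 1 T, (1 / (q : ℂ) ^ 4) * Sqa a 0 q

/-- The quadratic form `G(x) = Σ εᵢ xᵢ²`. -/
def Gquad (e : Fin 4 → ℤ) (x : Fin 4 → ℝ) : ℝ := ∑ i, (e i : ℝ) * x i ^ 2

/-- The singular integral `σ_∞(ε)`. -/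
def sigmaInf (e : Fin 4 → ℤ) : ℂ :=
  ∫ θ : ℝ, ∫ x in Set.univ.pi fun _ : Fin 4 => Set.Icc (-1 : ℝ) 1, eC (-(θ * Gquad e x))

/-- The weighted singular integral `σ_∞(w)`. -/
def sigmaInfW (w : (Fin 4 → ℝ) → ℝ) (e : Fin 4 → ℤ) : ℂ :=
  ∫ θ : ℝ, ∫ x : Fin 4 → ℝ, (w x : ℂ) * eC (-(θ * Gquad e x))

/-- `Pᵢ = (B / |aᵢ|)^{1/2}`. -/
def Pvec (a : Fin 4 → ℤ) (B : ℝ) (i : Fin 4) : ℝ := Real.sqrt (B / ((a i).natAbs : ℝ))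

/-- The oscillatory integral `I_{q,a}(c)`. -/
def Iqa (w : (Fin 4 → ℝ) → ℝ) (a : Fin 4 → ℤ) (B : ℝ) (c : Fin 4 → ℤ) (q : ℝ) : ℂ :=
  ∫ x : Fin 4 → ℝ,
    (w (fun i => x i / Pvec a B i) : ℂ) *
      (hFn (q / Real.sqrt B) ((∑ i, (a i : ℝ) * x i ^ 2) / B) : ℂ) *
      eC (-(∑ i, (c i : ℝ) * x i) / q)

/-- `Δ(v) = ∏ᵢ gcd(vᵢ, ∏_{j≠i} vⱼ)`. -/
def Delta4 (v : Fin 4 → ℤ) : ℕ :=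
  ∏ i, Int.gcd (v i) (∏ j ∈ Finset.univ.erase i, v j)

/-- `Δ_c(a) = ∏ᵢ gcd(gcd(aᵢ,cᵢ), ∏_{j≠i} gcd(aⱼ,cⱼ))`. -/
def DeltaC (a c : Fin 4 → ℤ) : ℕ :=
  ∏ i, Int.gcd (Int.gcd (a i) (c i) : ℤ) (∏ j ∈ Finset.univ.erase i, (Int.gcd (a j) (c j) : ℤ))

/-- The dual form `F*_a(c)`. -/
def dualForm (a c : Fin 4 → ℤ) : ℤ :=
  ∑ i, (∏ j ∈ Finset.univ.erase i, a j) * c i ^ 2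

/-- The counting function `N_a(B)`. -/
def Na (a : Fin 4 → ℤ) (B : ℝ) : ℕ :=
  {x : Fin 4 → ℤ | (∀ i, x i ≠ 0) ∧ (∑ i, a i * x i ^ 2) = 0 ∧
    ∀ i, (((a i * x i ^ 2).natAbs : ℝ)) ≤ B}.ncard

/-- The smoothly weighted counting function `N_{w,a}(B)`. -/
def Nwa (w : (Fin 4 → ℝ) → ℝ) (a : Fin 4 → ℤ) (B : ℝ) : ℝ :=
  ∑' x : Fin 4 → ℤ,
    if (∀ i, x i ≠ 0) ∧ (∑ i, a i * x i ^ 2) = 0 then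
      w fun i => (x i : ℝ) / Pvec a B i
    else 0

/-- The inclusion-exclusion weights `ω(r, s, s₀)`. -/
def omegaFn (r s : Fin 4 → ℕ) (s0 : ℕ) : ℤ :=
  if (∀ i, Squarefree (r i)) ∧ (∀ i, Squarefree (s i)) ∧
      Finset.univ.gcd s = 1 ∧ (∀ i, Nat.gcd s0 (s i) = 1) ∧
      ∀ p : ℕ, p.Prime → p ∣ (∏ i, r i) * ∏ i, s i → ∀ i, p ∣ r i * s i then
    ArithmeticFunction.moebius s0 *
      ∏ p ∈ ((∏ i, r i) * ∏ i, s i).primeFactors,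
        (-1 : ℤ) ^ (((∏ i, r i) * ∏ i, s i).factorization p + 1)
  else 0

/-- The cardinality of the set `𝒩(B; r, s, s₀)`. -/
def calN (B D : ℝ) (r s : Fin 4 → ℕ) (s0 : ℕ) : ℕ :=
  {z : Fin 4 → ℤ | (∀ i, z i ≠ 0) ∧ (∀ i, Squareful (z i)) ∧
    (∀ i, (((z i).natAbs : ℝ)) ≤ B) ∧ (∑ i, z i) = 0 ∧
    ∃ x y : Fin 4 → ℤ,
      (∀ i, 0 < x i ∧ Squarefree (y i) ∧ z i = x i ^ 2 * y i ^ 3 ∧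
        (r i : ℤ) ∣ y i ∧ (s i : ℤ) ∣ x i ∧ (s0 : ℤ) ∣ x i) ∧
      (((∏ i, y i).natAbs : ℝ)) ≤ D ∧ ¬ IsSquare (∏ i, y i)}.ncard

/-- The local counting function `M_n(y, p)`. -/
def Mcount (y : Fin 4 → ℤ) (p n : ℕ) : ℕ :=
  {m : Fin 4 → ℕ | (∀ i, m i < p ^ n) ∧ ((p : ℤ) ^ n ∣ ∑ i, y i ^ 3 * (m i : ℤ) ^ 2) ∧
    ∃ j, ¬ (p : ℤ) ∣ (m j : ℤ) * y j}.ncard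

end

lemma s14_divisor_bound (ε : ℝ) (hε : 0 < ε) :
    ∃ K : ℝ, 1 ≤ K ∧ ∀ n : ℕ, n ≠ 0 → (n.divisors.card : ℝ) ≤ K * (n : ℝ) ^ ε := by
  have h2 : 1 < (2 : ℝ) ^ ε := Real.one_lt_rpow (by norm_num) hε
  set t : ℝ := min 1 ((2 : ℝ) ^ ε - 1) with ht
  have ht0 : 0 < t := lt_min one_pos (by linarith)
  have ht1 : t ≤ 1 := min_le_left _ _
  have htb : t ≤ (2 : ℝ) ^ ε - 1 := min_le_right _ _
  set M : ℕ := ⌈(2 : ℝ) ^ (1 / ε)⌉₊ with hM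
  have hL1 : 1 ≤ t⁻¹ := (one_le_inv₀ ht0).2 ht1
  refine ⟨t⁻¹ ^ M, one_le_pow₀ hL1, fun n hn => ?_⟩
  have key : ∀ p ∈ n.primeFactors, ((n.factorization p + 1 : ℕ) : ℝ) ≤
      (if p < M then t⁻¹ else 1) * ((p : ℝ) ^ (n.factorization p)) ^ ε := by
    intro p hp
    have hpp := (Nat.prime_of_mem_primeFactors hp)
    have hp2 : (2 : ℝ) ≤ p := by exact_mod_cast hpp.two_le
    have e1 : ((p : ℝ) ^ (n.factorization p)) ^ ε = ((p : ℝ) ^ ε) ^ (n.factorization p) := by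
      rw [← Real.rpow_natCast, ← Real.rpow_natCast, ← Real.rpow_mul (by positivity),
        ← Real.rpow_mul (by positivity), mul_comm]
    rw [e1]
    set k := n.factorization p
    split_ifs with h
    · have h3 : (2 : ℝ) ^ ε ≤ (p : ℝ) ^ ε := Real.rpow_le_rpow (by norm_num) hp2 hε.le
      have h4 : 1 + (k : ℝ) * ((p : ℝ) ^ ε - 1) ≤ ((p : ℝ) ^ ε) ^ k := by
        have := one_add_mul_le_pow (a := (p : ℝ) ^ ε - 1) (by linarith) k
        simpa using this
      have h5 : t * ((k : ℝ) + 1) ≤ ((p : ℝ) ^ ε) ^ k := by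
        refine le_trans ?_ h4
        have : (k : ℝ) * t ≤ k * ((p : ℝ) ^ ε - 1) :=
          mul_le_mul_of_nonneg_left (by linarith) (by positivity)
        linarith
      rw [inv_mul_eq_div, le_div_iff₀ ht0]
      push_cast
      linarith
    · push Not at h
      have h3 : (2 : ℝ) ^ (1 / ε) ≤ p := (Nat.le_ceil _).trans (by exact_mod_cast h)
      have h4 : (2 : ℝ) ≤ (p : ℝ) ^ ε := by
        have := Real.rpow_le_rpow (by positivity) h3 hε.le
        rwa [← Real.rpow_mul (by norm_num), one_div, inv_mul_cancel₀ hε.ne', Real.rpow_one] at this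
      rw [one_mul]
      calc ((k + 1 : ℕ) : ℝ) ≤ (2 : ℝ) ^ k := by exact_mod_cast Nat.lt_two_pow_self
        _ ≤ _ := pow_le_pow_left₀ (by norm_num) h4 k
  rw [Nat.card_divisors hn]
  push_cast
  have hprod : (n : ℝ) ^ ε = ∏ p ∈ n.primeFactors, ((p : ℝ) ^ (n.factorization p)) ^ ε := by
    rw [Real.finsetProd_rpow _ _ (fun i _ => by positivity)]
    congr 1
    conv_lhs => rw [← Nat.prod_factorization_pow_eq_self hn]
    rw [Finsupp.prod]
    push_cast
    rfl
  calc ∏ p ∈ n.primeFactors, ((n.factorization p : ℝ) + 1)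
      ≤ ∏ p ∈ n.primeFactors, ((if p < M then t⁻¹ else 1) * ((p : ℝ) ^ (n.factorization p)) ^ ε) := by
        refine Finset.prod_le_prod (fun i _ => by positivity) (fun p hp => ?_)
        have := key p hp
        push_cast at this
        exact this
    _ = (∏ p ∈ n.primeFactors, (if p < M then t⁻¹ else 1)) * (n : ℝ) ^ ε := by
        rw [Finset.prod_mul_distrib, hprod]
    _ ≤ _ := by
        refine mul_le_mul_of_nonneg_right ?_ (by positivity)
        rw [Finset.prod_ite, Finset.prod_const, Finset.prod_const_one, mul_one]
        refine pow_le_pow_right₀ hL1 ?_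
        calc _ ≤ (Finset.range M).card := Finset.card_le_card (by
                intro x hx
                simp only [Finset.mem_filter] at hx
                exact Finset.mem_range.2 hx.2)
          _ = M := by simp

/-- multiples of d in a symmetric interval -/
lemma s14_count (d : ℕ) (hd : 0 < d) (X : ℝ) (hX : 0 ≤ X) (S : Finset ℤ)
    (hS : ∀ x ∈ S, (d : ℤ) ∣ x ∧ ((x.natAbs : ℕ) : ℝ) ≤ X) : (S.card : ℝ) ≤ 2 * (X / d) + 1 := by
  have hd' : (0 : ℝ) < d := by exact_mod_cast hd
  set N : ℕ := ⌊X / d⌋₊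
  have h1 : S.card ≤ (Finset.Icc (-(N : ℤ)) N).card := by
    refine Finset.card_le_card_of_injOn (fun x => x / d) ?_ ?_
    · intro x hx
      obtain ⟨⟨y, rfl⟩, h⟩ := hS x hx
      have : y.natAbs ≤ N := by
        refine Nat.le_floor ?_
        rw [le_div_iff₀ hd']
        rw [Int.natAbs_mul] at h
        push_cast at h
        simp only [Int.natAbs_natCast] at h
        push_cast
        linarith
      have e : (d : ℤ) * y / d = y := Int.mul_ediv_cancel_left y (by exact_mod_cast hd.ne')
      simp only [e, Finset.coe_Icc, Set.mem_Icc]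
      omega
    · intro x hx y hy hxy
      have hx' := (hS x hx).1
      have hy' := (hS y hy).1
      exact (Int.ediv_left_inj hx' hy').1 hxy
  have h2 : (Finset.Icc (-(N : ℤ)) N).card = 2 * N + 1 := by simp; omega
  rw [h2] at h1
  have h3 : (N : ℝ) ≤ X / d := Nat.floor_le (by positivity)
  have h4 : (S.card : ℝ) ≤ 2 * N + 1 := by exact_mod_cast h1
  linarith

lemma s14_comb (x y z w x' y' z' w' : ℕ) (hy : y' ≤ y) (hz : z' ≤ z) (hw : w' ≤ w)
    (h : y + z + w < x)
    (hc : 2 * x' < x → x + 2 * y' ≤ y + 2 * x' ∨ x + 2 * z' ≤ z + 2 * x' ∨ x + 2 * w' ≤ w + 2 * x') :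
    (x - 2 * x') + min x' (y' + z' + w') + ((y - 2 * y') + y') + ((z - 2 * z') + z')
     + ((w - 2 * w') + w') ≤ 2 * (y + z + w) := by
  omega

lemma s14_erase_sum (f : Fin 4 → ℕ) :
    (∑ j ∈ Finset.univ.erase (0 : Fin 4), f j) = f 1 + f 2 + f 3 ∧
    (∑ j ∈ Finset.univ.erase (1 : Fin 4), f j) = f 0 + f 2 + f 3 ∧
    (∑ j ∈ Finset.univ.erase (2 : Fin 4), f j) = f 0 + f 1 + f 3 ∧
    (∑ j ∈ Finset.univ.erase (3 : Fin 4), f j) = f 0 + f 1 + f 2 := by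
  have h := fun i : Fin 4 => Finset.add_sum_erase Finset.univ f (Finset.mem_univ i)
  simp only [Fin.sum_univ_four] at h
  have h0 := h 0
  have h1 := h 1
  have h2 := h 2
  have h3 := h 3
  refine ⟨?_, ?_, ?_, ?_⟩ <;> omega

lemma s14_local (α δ : Fin 4 → ℕ) (hd : ∀ i, δ i ≤ α i)
    (hc : ∀ i, 2 * δ i < α i → ∃ j, j ≠ i ∧ α i + 2 * δ j ≤ α j + 2 * δ i) :
    (∑ i, (α i - 2 * δ i)) + ∑ i, min (δ i) (∑ j ∈ Finset.univ.erase i, δ j) ≤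
      ∑ i, min (α i) (∑ j ∈ Finset.univ.erase i, α j) := by
  simp only [Fin.sum_univ_four, Fin.forall_fin_succ, Fin.exists_fin_succ] at *
  obtain ⟨a0, a1, a2, a3⟩ := s14_erase_sum α
  obtain ⟨b0, b1, b2, b3⟩ := s14_erase_sum δ
  rw [a0, a1, a2, a3, b0, b1, b2, b3]
  simp at hc hd
  obtain ⟨d0, d1, d2, d3⟩ := hd
  obtain ⟨c0, c1, c2, c3⟩ := hc
  by_cases h0 : α 1 + α 2 + α 3 < α 0
  · have := s14_comb _ _ _ _ _ _ _ _ d1 d2 d3 h0 c0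
    omega
  by_cases h1 : α 0 + α 2 + α 3 < α 1
  · have := s14_comb _ _ _ _ _ _ _ _ d0 d2 d3 h1 c1
    omega
  by_cases h2 : α 0 + α 1 + α 3 < α 2
  · have := s14_comb _ _ _ _ _ _ _ _ d0 d1 d3 h2 c2
    omega
  by_cases h3 : α 0 + α 1 + α 2 < α 3
  · have := s14_comb _ _ _ _ _ _ _ _ d0 d1 d2 h3 c3
    omega
  clear c0 c1 c2 c3
  have e0 : min (α 0) (α 1 + α 2 + α 3) = α 0 := by omega
  have e1 : min (α 1) (α 0 + α 2 + α 3) = α 1 := by omega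
  have e2 : min (α 2) (α 0 + α 1 + α 3) = α 2 := by omega
  have e3 : min (α 3) (α 0 + α 1 + α 2) = α 3 := by omega
  rw [e0, e1, e2, e3]
  have f0 := min_le_left (δ 0) (δ 1 + δ 2 + δ 3)
  have f1 := min_le_left (δ 1) (δ 0 + δ 2 + δ 3)
  have f2 := min_le_left (δ 2) (δ 0 + δ 1 + δ 3)
  have f3 := min_le_left (δ 3) (δ 0 + δ 1 + δ 2)
  omega

lemma s14_gcd_fact (x y : ℤ) (hx : x ≠ 0) (hy : y ≠ 0) (p : ℕ) :
    (Int.gcd x y).factorization p = min (x.natAbs.factorization p) (y.natAbs.factorization p) := by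
  rw [Int.gcd_eq_natAbs_gcd_natAbs, Nat.factorization_gcd (by simpa) (by simpa)]
  rfl

lemma s14_prod_fact (s : Finset (Fin 4)) (x : Fin 4 → ℤ) (hx : ∀ i, x i ≠ 0) (p : ℕ) :
    (∏ j ∈ s, x j).natAbs.factorization p = ∑ j ∈ s, (x j).natAbs.factorization p := by
  have h : (∏ j ∈ s, x j).natAbs = ∏ j ∈ s, (x j).natAbs := map_prod Int.natAbsHom x s
  rw [h, Nat.factorization_prod_apply]
  intro i _
  simpa using hx i

lemma s14_val (a c : Fin 4 → ℤ) (ha : ∀ i, a i ≠ 0) (hF : dualForm a c = 0) (p : ℕ)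
    (hp : p.Prime) (i : Fin 4)
    (hi : 2 * (Int.gcd (a i) (c i)).factorization p < (a i).natAbs.factorization p) :
    ∃ j, j ≠ i ∧ (a i).natAbs.factorization p + 2 * (Int.gcd (a j) (c j)).factorization p ≤
      (a j).natAbs.factorization p + 2 * (Int.gcd (a i) (c i)).factorization p := by
  by_contra! hcon
  set α : Fin 4 → ℕ := fun k => (a k).natAbs.factorization p with hα
  set δ : Fin 4 → ℕ := fun k => (Int.gcd (a k) (c k)).factorization p with hδ
  change 2 * δ i < α i at hi
  change ∀ j, j ≠ i → α j + 2 * δ i < α i + 2 * δ j at hcon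
  have hci : c i ≠ 0 := by
    intro h
    have : δ i = α i := by simp [hδ, hα, h]
    omega
  have hδi : (c i).natAbs.factorization p = δ i := by
    have : δ i = min (α i) _ := s14_gcd_fact (a i) (c i) (ha i) hci p
    omega
  set N := (∑ k ∈ Finset.univ.erase i, α k) + 2 * δ i with hN
  have hEi := Finset.add_sum_erase Finset.univ α (Finset.mem_univ i)
  have hadv : ∀ k, (p : ℤ) ^ α k ∣ a k := fun k => by
    rw [← Int.natCast_pow, Int.natCast_dvd]
    exact Nat.ordProj_dvd _ _
  have hcdv : ∀ k, (p : ℤ) ^ δ k ∣ c k := fun k => by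
    refine dvd_trans ?_ (Int.gcd_dvd_right (a k) (c k))
    exact_mod_cast Nat.ordProj_dvd (Int.gcd (a k) (c k)) p
  have hterm : ∀ j ∈ Finset.univ.erase i,
      (p : ℤ) ^ (N + 1) ∣ (∏ k ∈ Finset.univ.erase j, a k) * c j ^ 2 := by
    intro j hj
    have hj' := hcon j (Finset.ne_of_mem_erase hj)
    have hEj := Finset.add_sum_erase Finset.univ α (Finset.mem_univ j)
    have h1 : (p : ℤ) ^ ((∑ k ∈ Finset.univ.erase j, α k) + δ j * 2) ∣
        (∏ k ∈ Finset.univ.erase j, a k) * c j ^ 2 := by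
      rw [pow_add, pow_mul, ← Finset.prod_pow_eq_pow_sum]
      exact mul_dvd_mul (Finset.prod_dvd_prod_of_dvd _ _ fun k _ => hadv k) (pow_dvd_pow_of_dvd (hcdv j) 2)
    exact (pow_dvd_pow _ (by omega)).trans h1
  have hsum := Finset.dvd_sum hterm
  have hF' := Finset.add_sum_erase Finset.univ (fun j => (∏ k ∈ Finset.univ.erase j, a k) * c j ^ 2) (Finset.mem_univ i)
  rw [show (∑ j, (∏ k ∈ Finset.univ.erase j, a k) * c j ^ 2) = 0 from hF] at hF'
  have hti : (p : ℤ) ^ (N + 1) ∣ (∏ k ∈ Finset.univ.erase i, a k) * c i ^ 2 := by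
    rw [eq_neg_of_add_eq_zero_left hF']
    exact (dvd_neg).2 hsum
  have hP : (∏ k ∈ Finset.univ.erase i, a k) ≠ 0 := Finset.prod_ne_zero_iff.2 fun k _ => ha k
  rw [← Int.natCast_pow, Int.natCast_dvd, Int.natAbs_mul, Int.natAbs_pow,
    hp.pow_dvd_iff_le_factorization (by simp [hci, hP]), Nat.factorization_mul (by simpa) (by simpa),
    Nat.factorization_pow] at hti
  have := s14_prod_fact (Finset.univ.erase i) a ha p
  simp only [Finsupp.add_apply, Finsupp.smul_apply, smul_eq_mul, hδi, this] at hti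
  change N + 1 ≤ (∑ k ∈ Finset.univ.erase i, α k) + _ at hti
  omega

/-- The integer `|a| / gcd(|a|, d²)`. -/
def s14_m (x : ℤ) (d : ℕ) : ℕ := x.natAbs / Nat.gcd x.natAbs (d ^ 2)

lemma s14_m_pos (x : ℤ) (d : ℕ) (hx : x ≠ 0) : 1 ≤ s14_m x d := by
  have : 0 < x.natAbs := by omega
  exact Nat.div_pos (Nat.gcd_le_left _ this) (Nat.gcd_pos_of_pos_left _ this)

lemma s14_m_mul (x : ℤ) (d : ℕ) (hd : 0 < d) : x.natAbs ≤ s14_m x d * d ^ 2 := by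
  have h := Nat.div_mul_cancel (Nat.gcd_dvd_left x.natAbs (d ^ 2))
  calc x.natAbs = s14_m x d * Nat.gcd x.natAbs (d ^ 2) := h.symm
    _ ≤ _ := Nat.mul_le_mul_left _ (Nat.gcd_le_right _ (by positivity))

lemma s14_m_fact (x : ℤ) (d : ℕ) (hx : x ≠ 0) (hd : 0 < d) (p : ℕ) :
    (s14_m x d).factorization p = x.natAbs.factorization p - 2 * d.factorization p := by
  rw [s14_m, Nat.factorization_div (Nat.gcd_dvd_left _ _),
    Nat.factorization_gcd (by simpa) (by positivity), Nat.factorization_pow]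
  simp only [Finsupp.tsub_apply, Finsupp.inf_apply, Finsupp.smul_apply, smul_eq_mul]
  omega

lemma s14_dvd (a c : Fin 4 → ℤ) (ha : ∀ i, a i ≠ 0) (hF : dualForm a c = 0) :
    (∏ i, s14_m (a i) (Int.gcd (a i) (c i))) * DeltaC a c ∣ Delta4 a := by
  have hg : ∀ i, 0 < Int.gcd (a i) (c i) := fun i => Int.gcd_pos_of_ne_zero_left _ (ha i)
  have hg' : ∀ i, ((Int.gcd (a i) (c i) : ℕ) : ℤ) ≠ 0 := fun i => by exact_mod_cast (hg i).ne'
  have hm : ∀ i, s14_m (a i) (Int.gcd (a i) (c i)) ≠ 0 :=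
    fun i => (Nat.lt_of_lt_of_le Nat.zero_lt_one (s14_m_pos _ _ (ha i))).ne'
  have hP1 : ∀ i, (∏ k ∈ Finset.univ.erase i, a k) ≠ 0 := fun i => Finset.prod_ne_zero_iff.2 fun k _ => ha k
  have hP2 : ∀ i, (∏ k ∈ Finset.univ.erase i, ((Int.gcd (a k) (c k) : ℕ) : ℤ)) ≠ 0 :=
    fun i => Finset.prod_ne_zero_iff.2 fun k _ => hg' k
  have hDa : ∀ i, Int.gcd (a i) (∏ j ∈ Finset.univ.erase i, a j) ≠ 0 :=
    fun i => (Int.gcd_pos_of_ne_zero_left _ (ha i)).ne'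
  have hDc : ∀ i, Int.gcd (Int.gcd (a i) (c i) : ℤ) (∏ j ∈ Finset.univ.erase i, (Int.gcd (a j) (c j) : ℤ)) ≠ 0 :=
    fun i => (Int.gcd_pos_of_ne_zero_left _ (hg' i)).ne'
  have hD1 : Delta4 a ≠ 0 := Finset.prod_ne_zero_iff.2 fun i _ => hDa i
  have hD2 : DeltaC a c ≠ 0 := Finset.prod_ne_zero_iff.2 fun i _ => hDc i
  have hM : (∏ i, s14_m (a i) (Int.gcd (a i) (c i))) ≠ 0 := Finset.prod_ne_zero_iff.2 fun i _ => hm i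
  rw [← Nat.factorization_prime_le_iff_dvd (mul_ne_zero hM hD2) hD1]
  intro p hp
  rw [Nat.factorization_mul hM hD2, Finsupp.add_apply, Nat.factorization_prod_apply (fun i _ => hm i),
    DeltaC, Delta4, Nat.factorization_prod_apply (fun i _ => hDa i),
    Nat.factorization_prod_apply (fun i _ => hDc i)]
  simp_rw [fun i => s14_m_fact (a i) _ (ha i) (hg i) p, fun i => s14_gcd_fact _ _ (ha i) (hP1 i) p,
    fun i => s14_gcd_fact _ _ (hg' i) (hP2 i) p, fun i => s14_prod_fact (Finset.univ.erase i) a ha p,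
    fun i => s14_prod_fact (Finset.univ.erase i) (fun k => ((Int.gcd (a k) (c k) : ℕ) : ℤ)) hg' p,
    Int.natAbs_natCast]
  refine s14_local (fun i => (a i).natAbs.factorization p) (fun i => (Int.gcd (a i) (c i)).factorization p) ?_
    (fun i hi => s14_val a c ha hF p hp i hi)
  intro i
  have : Int.gcd (a i) (c i) ∣ (a i).natAbs := Int.natCast_dvd.1 (Int.gcd_dvd_left _ _)
  exact (Nat.factorization_le_iff_dvd (hg i).ne' (by simpa using ha i)).2 this p

lemma s14_fiber (a : Fin 4 → ℤ) (C : ℝ) (ha : ∀ i, a i ≠ 0) (hC : 1 ≤ C) (d : Fin 4 → ℕ)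
    (hd : ∀ i, 0 < d i) (S : Finset (Fin 4 → ℤ))
    (hS : ∀ c ∈ S, (∀ i, (d i : ℤ) ∣ c i) ∧
      (∀ i, ((c i).natAbs : ℝ) ≤ C * Real.sqrt (((a i).natAbs : ℝ))) ∧ dualForm a c = 0)
    (k : Fin 4) :
    (S.card : ℝ) ≤ 2 * ∏ i ∈ Finset.univ.erase k, (3 * C * Real.sqrt (s14_m (a i) (d i) : ℝ)) := by
  have hP : (∏ j ∈ Finset.univ.erase k, a j) ≠ 0 := Finset.prod_ne_zero_iff.2 fun j _ => ha j
  have h1 : S.card ≤ 2 * (S.image fun c => Function.update c k 0).card := by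
    refine Finset.card_le_mul_card_image S 2 ?_
    intro b hb
    obtain ⟨x, hx, rfl⟩ := Finset.mem_image.1 hb
    refine (Finset.card_le_card (t := {x, Function.update x k (-x k)}) ?_).trans Finset.card_le_two
    intro y hy
    obtain ⟨hyS, hyx⟩ := Finset.mem_filter.1 hy
    have hne : ∀ j, j ≠ k → y j = x j := fun j hj => by
      have := congrFun hyx j
      simpa [Function.update_of_ne hj] using this
    have ex := (hS x hx).2.2
    have ey := (hS y hyS).2.2
    rw [dualForm, ← Finset.add_sum_erase _ _ (Finset.mem_univ k)] at ex ey
    have er : ∑ j ∈ Finset.univ.erase k, (∏ l ∈ Finset.univ.erase j, a l) * y j ^ 2 =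
        ∑ j ∈ Finset.univ.erase k, (∏ l ∈ Finset.univ.erase j, a l) * x j ^ 2 :=
      Finset.sum_congr rfl fun j hj => by rw [hne j (Finset.ne_of_mem_erase hj)]
    rw [er] at ey
    have esq : y k ^ 2 = x k ^ 2 := mul_left_cancel₀ hP (by linarith)
    simp only [Finset.mem_insert, Finset.mem_singleton]
    rcases sq_eq_sq_iff_eq_or_eq_neg.1 esq with h | h
    · left
      funext j
      by_cases hj : j = k
      · subst hj; exact h
      · exact hne j hj
    · right
      funext j
      by_cases hj : j = k
      · subst hj; simpa using h
      · rw [Function.update_of_ne hj]; exact hne j hj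
  have h2 : (S.image fun c => Function.update c k 0).card ≤
      ∏ i ∈ Finset.univ.erase k, (S.image fun c => c i).card := by
    calc _ ≤ (Fintype.piFinset fun i => if i = k then {0} else S.image fun c => c i).card := by
          refine Finset.card_le_card ?_
          intro b hb
          obtain ⟨x, hx, rfl⟩ := Finset.mem_image.1 hb
          rw [Fintype.mem_piFinset]
          intro i
          by_cases hi : i = k
          · subst hi; simp
          · simp only [hi, if_false, Function.update_of_ne hi]
            exact Finset.mem_image_of_mem _ hx
      _ = _ := by
          rw [Fintype.card_piFinset, ← Finset.mul_prod_erase _ _ (Finset.mem_univ k)]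
          simp only [if_true, Finset.card_singleton, one_mul]
          exact Finset.prod_congr rfl fun i hi => by rw [if_neg (Finset.ne_of_mem_erase hi)]
  have h3 : ∀ i, ((S.image fun c => c i).card : ℝ) ≤ 3 * C * Real.sqrt (s14_m (a i) (d i) : ℝ) := by
    intro i
    have hdi : (0 : ℝ) < d i := by exact_mod_cast hd i
    have hb := s14_count (d i) (hd i) (C * Real.sqrt (((a i).natAbs : ℝ))) (by positivity)
      (S.image fun c => c i) (by
        intro x hx
        obtain ⟨c, hc, rfl⟩ := Finset.mem_image.1 hx
        exact ⟨(hS c hc).1 i, (hS c hc).2.1 i⟩)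
    have hm1 : (1 : ℝ) ≤ Real.sqrt (s14_m (a i) (d i) : ℝ) := by
      rw [Real.one_le_sqrt]
      exact_mod_cast s14_m_pos _ _ (ha i)
    have hm2 : Real.sqrt ((a i).natAbs : ℝ) ≤ Real.sqrt (s14_m (a i) (d i) : ℝ) * d i := by
      rw [Real.sqrt_le_left (by positivity), mul_pow, Real.sq_sqrt (by positivity)]
      exact_mod_cast s14_m_mul (a i) (d i) (hd i)
    have hq : C * Real.sqrt ((a i).natAbs : ℝ) / d i ≤ C * Real.sqrt (s14_m (a i) (d i) : ℝ) := by
      rw [div_le_iff₀ hdi, mul_assoc]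
      exact mul_le_mul_of_nonneg_left hm2 (by linarith)
    have : 1 ≤ C * Real.sqrt (s14_m (a i) (d i) : ℝ) := one_le_mul_of_one_le_of_one_le hC hm1
    linarith
  calc (S.card : ℝ) ≤ 2 * ∏ i ∈ Finset.univ.erase k, ((S.image fun c => c i).card : ℝ) := by
        exact_mod_cast h1.trans (Nat.mul_le_mul_left 2 h2)
    _ ≤ _ := by
        refine mul_le_mul_of_nonneg_left ?_ (by norm_num)
        exact Finset.prod_le_prod (fun i _ => by positivity) fun i _ => h3 i

lemma s14_erase_prod (f : Fin 4 → ℝ) :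
    (∏ k, ∏ j ∈ Finset.univ.erase k, f j) = (∏ i, f i) ^ 3 := by
  have h0 : (Finset.univ.erase (0 : Fin 4)) = {1, 2, 3} := by decide
  have h1 : (Finset.univ.erase (1 : Fin 4)) = {0, 2, 3} := by decide
  have h2 : (Finset.univ.erase (2 : Fin 4)) = {0, 1, 3} := by decide
  have h3 : (Finset.univ.erase (3 : Fin 4)) = {0, 1, 2} := by decide
  simp only [Fin.prod_univ_four, h0, h1, h2, h3]
  simp
  ring

lemma s14_fiber' (a : Fin 4 → ℤ) (C : ℝ) (ha : ∀ i, a i ≠ 0) (hC : 1 ≤ C) (d : Fin 4 → ℕ)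
    (hd : ∀ i, 0 < d i) (S : Finset (Fin 4 → ℤ))
    (hS : ∀ c ∈ S, (∀ i, (d i : ℤ) ∣ c i) ∧
      (∀ i, ((c i).natAbs : ℝ) ≤ C * Real.sqrt (((a i).natAbs : ℝ))) ∧ dualForm a c = 0) :
    (S.card : ℝ) ≤ 54 * C ^ 3 * ((∏ i, s14_m (a i) (d i) : ℕ) : ℝ) ^ ((3 : ℝ) / 8) := by
  have hC0 : 0 < C := by linarith
  rw [← pow_le_pow_iff_left₀ (by positivity) (by positivity) (n := 4) (by norm_num)]
  calc (S.card : ℝ) ^ 4 = ∏ k : Fin 4, (S.card : ℝ) := by simp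
    _ ≤ ∏ k : Fin 4, (2 * ∏ i ∈ Finset.univ.erase k, (3 * C * Real.sqrt (s14_m (a i) (d i) : ℝ))) :=
        Finset.prod_le_prod (fun i _ => by positivity) fun k _ => s14_fiber a C ha hC d hd S hS k
    _ = (54 * C ^ 3) ^ 4 * (∏ i, Real.sqrt (s14_m (a i) (d i) : ℝ)) ^ 3 := by
        rw [Finset.prod_mul_distrib, s14_erase_prod, Finset.prod_mul_distrib]
        simp only [Finset.prod_const, Finset.card_univ, Fintype.card_fin]
        ring
    _ = _ := by
        rw [mul_pow _ (_ ^ ((3 : ℝ) / 8))]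
        congr 1
        push_cast
        simp_rw [Real.sqrt_eq_rpow]
        rw [Real.finsetProd_rpow _ _ (fun i _ => by positivity), ← Real.rpow_natCast,
          ← Real.rpow_natCast, ← Real.rpow_mul (by positivity), ← Real.rpow_mul (by positivity)]
        norm_num

/-- Lemma 4.15: the bound for the sum of `Δ_c(a)^{3/8}` over the dual-form zeros. -/
theorem statement_14 (ε : ℝ) (hε : 0 < ε) :
    ∃ K : ℝ, 0 < K ∧
      ∀ (a : Fin 4 → ℤ) (C : ℝ), (∀ i, a i ≠ 0) → 1 ≤ C →
        (∑' c : Fin 4 → ℤ,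
            if c ≠ 0 ∧ (∀ i, ((c i).natAbs : ℝ) ≤ C * Real.sqrt (((a i).natAbs : ℝ))) ∧
                dualForm a c = 0 then
              (DeltaC a c : ℝ) ^ ((3 : ℝ) / 8)
            else 0) ≤
          K * C ^ 3 * (((∏ i, a i).natAbs : ℝ)) ^ ε * (Delta4 a : ℝ) ^ ((1 : ℝ) / 2) := by
  classical
  obtain ⟨K, hK1, hK⟩ := s14_divisor_bound ε hε
  refine ⟨54 * K ^ 4, by positivity, fun a C ha hC => ?_⟩
  have hC0 : 0 < C := by linarith
  set Q : (Fin 4 → ℤ) → Prop := fun c => c ≠ 0 ∧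
    (∀ i, ((c i).natAbs : ℝ) ≤ C * Real.sqrt (((a i).natAbs : ℝ))) ∧ dualForm a c = 0 with hQ
  set B : Finset (Fin 4 → ℤ) := (Fintype.piFinset fun i =>
    Finset.Icc (-(⌊C * Real.sqrt (((a i).natAbs : ℝ))⌋₊ : ℤ)) ⌊C * Real.sqrt (((a i).natAbs : ℝ))⌋₊).filter Q
    with hB
  have hmem : ∀ c, c ∈ B ↔ Q c := by
    intro c
    rw [hB, Finset.mem_filter, and_iff_right_iff_imp, Fintype.mem_piFinset]
    intro h i
    have := Nat.le_floor (h.2.1 i)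
    rw [Finset.mem_Icc]
    omega
  have hsum : (∑' c : Fin 4 → ℤ, if c ≠ 0 ∧
      (∀ i, ((c i).natAbs : ℝ) ≤ C * Real.sqrt (((a i).natAbs : ℝ))) ∧ dualForm a c = 0 then
        (DeltaC a c : ℝ) ^ ((3 : ℝ) / 8) else 0) = ∑ c ∈ B, (DeltaC a c : ℝ) ^ ((3 : ℝ) / 8) := by
    rw [tsum_eq_sum (s := B)]
    · exact Finset.sum_congr rfl fun c hc => if_pos ((hmem c).1 hc)
    · intro c hc
      exact if_neg fun h => hc ((hmem c).2 h)
  rw [hsum]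
  set T : Finset (Fin 4 → ℕ) := Fintype.piFinset fun i => (a i).natAbs.divisors with hT
  have hmaps : ∀ c ∈ B, (fun i => Int.gcd (a i) (c i)) ∈ T := by
    intro c _
    rw [hT, Fintype.mem_piFinset]
    intro i
    rw [Nat.mem_divisors]
    exact ⟨Int.natCast_dvd.1 (Int.gcd_dvd_left _ _), by simpa using ha i⟩
  have hD1 : (1 : ℝ) ≤ (Delta4 a : ℝ) := by
    have : Delta4 a ≠ 0 := Finset.prod_ne_zero_iff.2 fun i _ =>
      (Int.gcd_pos_of_ne_zero_left _ (ha i)).ne'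
    exact_mod_cast Nat.one_le_iff_ne_zero.2 this
  have hfib : ∀ d ∈ T, (∑ c ∈ B with (fun i => Int.gcd (a i) (c i)) = d,
      (DeltaC a c : ℝ) ^ ((3 : ℝ) / 8)) ≤ 54 * C ^ 3 * (Delta4 a : ℝ) ^ ((1 : ℝ) / 2) := by
    intro d hd
    have hdpos : ∀ i, 0 < d i := fun i => Nat.pos_of_mem_divisors (Fintype.mem_piFinset.1 hd i)
    set S := B.filter fun c => (fun i => Int.gcd (a i) (c i)) = d with hSdef
    rcases S.eq_empty_or_nonempty with hE | ⟨c0, hc0⟩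
    · rw [hE, Finset.sum_empty]
      positivity
    have hcard := s14_fiber' a C ha hC d hdpos S (by
      intro c hc
      obtain ⟨h1, h2⟩ := Finset.mem_filter.1 hc
      have h3 := (hmem c).1 h1
      refine ⟨fun i => ?_, h3.2⟩
      rw [← h2]
      exact Int.gcd_dvd_right _ _)
    obtain ⟨h1, h2⟩ := Finset.mem_filter.1 hc0
    have hdv := s14_dvd a c0 ha ((hmem c0).1 h1).2.2
    have hg : ∀ i, Int.gcd (a i) (c0 i) = d i := fun i => congrFun h2 i
    simp only [hg] at hdv
    have hle := Nat.le_of_dvd (by exact_mod_cast (zero_lt_one.trans_le hD1)) hdv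
    have hconst : ∀ c ∈ S, (DeltaC a c : ℝ) ^ ((3 : ℝ) / 8) = (DeltaC a c0 : ℝ) ^ ((3 : ℝ) / 8) := by
      intro c hc
      have h4 := (Finset.mem_filter.1 hc).2
      have hg' : ∀ i, Int.gcd (a i) (c i) = d i := fun i => congrFun h4 i
      have : DeltaC a c = DeltaC a c0 := by
        simp only [DeltaC, hg, hg']
      rw [this]
    rw [Finset.sum_congr rfl hconst, Finset.sum_const, nsmul_eq_mul]
    calc (S.card : ℝ) * (DeltaC a c0 : ℝ) ^ ((3 : ℝ) / 8)
        ≤ 54 * C ^ 3 * ((∏ i, s14_m (a i) (d i) : ℕ) : ℝ) ^ ((3 : ℝ) / 8) *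
          (DeltaC a c0 : ℝ) ^ ((3 : ℝ) / 8) := mul_le_mul_of_nonneg_right hcard (by positivity)
      _ = 54 * C ^ 3 * (((∏ i, s14_m (a i) (d i)) * DeltaC a c0 : ℕ) : ℝ) ^ ((3 : ℝ) / 8) := by
          rw [mul_assoc, ← Real.mul_rpow (by positivity) (by positivity), Nat.cast_mul]
      _ ≤ 54 * C ^ 3 * (Delta4 a : ℝ) ^ ((3 : ℝ) / 8) := by
          refine mul_le_mul_of_nonneg_left ?_ (by positivity)
          exact Real.rpow_le_rpow (by positivity) (by exact_mod_cast hle) (by norm_num)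
      _ ≤ _ := by
          refine mul_le_mul_of_nonneg_left ?_ (by positivity)
          exact Real.rpow_le_rpow_of_exponent_le hD1 (by norm_num)
  have hTcard : (T.card : ℝ) ≤ K ^ 4 * (((∏ i, a i).natAbs : ℝ)) ^ ε := by
    have hA : (∏ i, a i).natAbs = ∏ i, (a i).natAbs := map_prod Int.natAbsHom a Finset.univ
    rw [hT, Fintype.card_piFinset, hA]
    push_cast
    rw [← Real.finsetProd_rpow _ _ (fun i _ => by positivity)]
    calc _ ≤ ∏ i : Fin 4, (K * ((a i).natAbs : ℝ) ^ ε) :=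
          Finset.prod_le_prod (fun i _ => by positivity) fun i _ => hK _ (by simpa using ha i)
      _ = _ := by
          rw [Finset.prod_mul_distrib]
          simp
  rw [← Finset.sum_fiberwise_of_maps_to hmaps]
  calc _ ≤ ∑ d ∈ T, 54 * C ^ 3 * (Delta4 a : ℝ) ^ ((1 : ℝ) / 2) := Finset.sum_le_sum hfib
    _ = (T.card : ℝ) * (54 * C ^ 3 * (Delta4 a : ℝ) ^ ((1 : ℝ) / 2)) := by
        rw [Finset.sum_const, nsmul_eq_mul]
    _ ≤ (K ^ 4 * (((∏ i, a i).natAbs : ℝ)) ^ ε) * (54 * C ^ 3 * (Delta4 a : ℝ) ^ ((1 : ℝ) / 2)) :=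
        mul_le_mul_of_nonneg_right hTcard (by positivity)
    _ = _ := by ring
end

section
/- Let a ∈ (ℤ\{0})⁴ and assume that A = a₁a₂a₃a₄ is not a perfect square. Then the limit 𝔊_a = lim_{T→∞} Σ_{q≤T} q⁻⁴·S_{q,a}(0) exists, and for every ε > 0, |𝔊_a| ≪_ε |A|^ε·Δ^{1/4}, where the implied constant depends only on ε. -/
open scoped BigOperators
open MeasureTheory Filter

attribute [local instance 0] Classical.propDecidable

/-! ### Part 1: convolution of an absolutely convergent and a convergent series -/

lemma conv_partial (u v : ArithmeticFunction ℂ) (hu : Summable fun n => ‖u n‖) (B : ℝ)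
    (hB : ∀ N : ℕ, ‖∑ m ∈ Finset.Ioc 0 N, v m‖ ≤ B) (L : ℂ)
    (hL : Tendsto (fun N : ℕ => ∑ m ∈ Finset.Ioc 0 N, v m) atTop (nhds L)) :
    (∃ L' : ℂ, Tendsto (fun N : ℕ => ∑ n ∈ Finset.Ioc 0 N, (u * v) n) atTop (nhds L')) ∧
      ∀ N : ℕ, ‖∑ n ∈ Finset.Ioc 0 N, (u * v) n‖ ≤ (∑' n, ‖u n‖) * B := by
  have hB0 : 0 ≤ B := (norm_nonneg _).trans (hB 0)
  have key : ∀ N : ℕ, ∑ n ∈ Finset.Ioc 0 N, (u * v) n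
      = ∑ n ∈ Finset.Ioc 0 N, u n * ∑ m ∈ Finset.Ioc 0 (N / n), v m :=
    fun N => ArithmeticFunction.sum_Ioc_mul_eq_sum_sum u v N
  have key2 : ∀ N : ℕ, ∑ n ∈ Finset.Ioc 0 N, (u * v) n
      = ∑' n, u n * ∑ m ∈ Finset.Ioc 0 (N / n), v m := by
    intro N
    rw [key N]
    symm
    apply tsum_eq_sum
    intro n hn
    simp only [Finset.mem_Ioc, not_and, not_le] at hn
    rcases Nat.eq_zero_or_pos n with h | h
    · simp [h]
    · rw [Nat.div_eq_of_lt (hn h)]; simp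
  constructor
  · refine ⟨∑' n, u n * L, ?_⟩
    simp_rw [key2]
    apply tendsto_tsum_of_dominated_convergence (bound := fun n => ‖u n‖ * B)
    · exact hu.mul_right B
    · intro n
      rcases Nat.eq_zero_or_pos n with h | h
      · simp [h]
      · apply Tendsto.const_mul
        exact hL.comp (Nat.tendsto_div_const_atTop h.ne')
    · filter_upwards with N n
      rw [norm_mul]
      gcongr
      exact hB _
  · intro N
    rw [key N]
    calc _ ≤ ∑ n ∈ Finset.Ioc 0 N, ‖u n‖ * B := by
            refine (norm_sum_le _ _).trans (Finset.sum_le_sum fun n _ => ?_)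
            rw [norm_mul]
            gcongr
            exact hB _
      _ = (∑ n ∈ Finset.Ioc 0 N, ‖u n‖) * B := by rw [Finset.sum_mul]
      _ ≤ _ := by
            gcongr
            exact hu.sum_le_tsum _ (fun _ _ => norm_nonneg _)

/-! ### Part 2: series `∑ χ(m)/m` for a periodic sequence of mean zero -/

lemma periodic_partial (c : ℕ → ℂ) (N : ℕ) (hN : 0 < N) (hc : ∀ n, ‖c n‖ ≤ 1)
    (hper : ∀ n, c (n + N) = c n) (hz : ∑ n ∈ Finset.range N, c n = 0) (M : ℕ) :
    ‖∑ n ∈ Finset.range M, c n‖ ≤ N := by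
  induction M using Nat.strong_induction_on with
  | _ M ih =>
    rcases lt_or_ge M N with h | h
    · calc _ ≤ ∑ n ∈ Finset.range M, (1 : ℝ) := norm_sum_le_of_le _ fun n _ => hc n
        _ = M := by simp
        _ ≤ N := by exact_mod_cast h.le
    · obtain ⟨K, rfl⟩ := Nat.exists_eq_add_of_le h
      rw [Finset.sum_range_add, hz, zero_add]
      have : ∀ n, c (N + n) = c n := fun n => by rw [add_comm]; exact hper n
      simp_rw [this]
      exact ih K (by omega)

/-- Abel summation bound. -/
lemma abel_tail (c : ℕ → ℂ) (K : ℝ) (hK : ∀ M, ‖∑ n ∈ Finset.range M, c n‖ ≤ K) (M X : ℕ)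
    (hM : 0 < M) (hMX : M ≤ X) :
    ‖∑ n ∈ Finset.Ico M X, c n / n‖ ≤ 2 * K / M := by
  have hK0 : 0 ≤ K := (norm_nonneg _).trans (hK 0)
  have hid : ∀ X, M ≤ X → ∑ n ∈ Finset.Ico M X, c n / (n : ℂ)
      = (∑ n ∈ Finset.range X, c n) / (X : ℂ) - (∑ n ∈ Finset.range M, c n) / (M : ℂ)
        + ∑ n ∈ Finset.Ico M X, (∑ j ∈ Finset.range (n + 1), c j) * ((1 : ℂ) / n - 1 / (n + 1)) := by
    intro X hX
    induction X, hX using Nat.le_induction with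
    | base => simp
    | succ X hX ih =>
      rw [Finset.sum_Ico_succ_top hX, Finset.sum_Ico_succ_top hX, ih, Finset.sum_range_succ]
      have h1 : (X : ℂ) ≠ 0 := by exact_mod_cast (by omega : X ≠ 0)
      have h2 : (X : ℂ) + 1 ≠ 0 := by exact_mod_cast (by omega : X + 1 ≠ 0)
      push_cast
      field_simp
      ring
  have htel : ∀ X, M ≤ X → ∑ n ∈ Finset.Ico M X, K * ((1 : ℝ) / n - 1 / (n + 1))
      = K * (1 / M - 1 / X) := by
    intro X hX
    induction X, hX using Nat.le_induction with
    | base => simp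
    | succ X hX ih =>
      rw [Finset.sum_Ico_succ_top hX, ih]
      push_cast
      ring
  have hX : 0 < X := by omega
  have hMr : (0 : ℝ) < M := by exact_mod_cast hM
  have hXr : (0 : ℝ) < X := by exact_mod_cast hX
  rw [hid X hMX]
  have e1 : ‖(∑ n ∈ Finset.range X, c n) / (X : ℂ)‖ ≤ K / X := by
    rw [norm_div, Complex.norm_natCast]; gcongr; exact hK X
  have e2 : ‖(∑ n ∈ Finset.range M, c n) / (M : ℂ)‖ ≤ K / M := by
    rw [norm_div, Complex.norm_natCast]; gcongr; exact hK M
  have e3 : ‖∑ n ∈ Finset.Ico M X, (∑ j ∈ Finset.range (n + 1), c j)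
      * ((1 : ℂ) / n - 1 / (n + 1))‖ ≤ K * (1 / M - 1 / X) := by
    rw [← htel X hMX]
    apply norm_sum_le_of_le
    intro n hn
    have hn0 : 0 < n := by have := (Finset.mem_Ico.mp hn).1; omega
    have hnr : (0 : ℝ) < n := by exact_mod_cast hn0
    rw [norm_mul]
    have : ((1 : ℂ) / n - 1 / (n + 1)) = (((1 : ℝ) / n - 1 / (n + 1) : ℝ) : ℂ) := by push_cast; rfl
    rw [this, Complex.norm_real, Real.norm_of_nonneg]
    · gcongr
      · have : (1 : ℝ) / (n + 1) ≤ 1 / n := by gcongr; linarith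
        linarith
      · exact hK _
    · have : (1 : ℝ) / (n + 1) ≤ 1 / n := by gcongr; linarith
      linarith
  calc _ ≤ K / X + K / M + K * (1 / M - 1 / X) :=
        (norm_add_le _ _).trans (add_le_add ((norm_sub_le _ _).trans (add_le_add e1 e2)) e3)
    _ = _ := by ring

lemma char_series (c : ℕ → ℂ) (N : ℕ) (hN : 0 < N) (hc : ∀ n, ‖c n‖ ≤ 1)
    (hper : ∀ n, c (n + N) = c n) (hz : ∑ n ∈ Finset.range N, c n = 0) :
    (∃ L : ℂ, Tendsto (fun X : ℕ => ∑ m ∈ Finset.Ioc 0 X, c m / (m : ℂ)) atTop (nhds L)) ∧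
      ∀ X : ℕ, ‖∑ m ∈ Finset.Ioc 0 X, c m / (m : ℂ)‖ ≤ 3 + Real.log N := by
  have hK := periodic_partial c N hN hc hper hz
  have hI : ∀ X : ℕ, Finset.Ioc 0 X = Finset.Ico 1 (X + 1) := by intro X; ext; simp; omega
  have hNr : (0 : ℝ) < N := by exact_mod_cast hN
  have small : ∀ X : ℕ, X ≤ N → ‖∑ m ∈ Finset.Ioc 0 X, c m / (m : ℂ)‖ ≤ 1 + Real.log N := by
    intro X hX
    calc _ ≤ ∑ m ∈ Finset.Ioc 0 X, ((m : ℝ))⁻¹ := by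
          apply norm_sum_le_of_le
          intro n hn
          rw [norm_div, Complex.norm_natCast, div_eq_mul_inv]
          exact mul_le_of_le_one_left (by positivity) (hc n)
      _ ≤ ∑ m ∈ Finset.Ioc 0 N, ((m : ℝ))⁻¹ := by
          apply Finset.sum_le_sum_of_subset_of_nonneg
          · exact Finset.Ioc_subset_Ioc_right hX
          · intros; positivity
      _ = ((harmonic N : ℚ) : ℝ) := by
          rw [harmonic_eq_sum_Icc]; push_cast; rfl
      _ ≤ _ := harmonic_le_one_add_log N
  constructor
  · apply cauchySeq_tendsto_of_complete
    refine cauchySeq_of_le_tendsto_0 (fun n : ℕ => 2 * (2 * (N : ℝ) / ((n : ℝ) + 1))) ?_ ?_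
    · have tail : ∀ n Y : ℕ, n ≤ Y → dist (∑ m ∈ Finset.Ioc 0 Y, c m / (m : ℂ))
          (∑ m ∈ Finset.Ioc 0 n, c m / (m : ℂ)) ≤ 2 * (N : ℝ) / ((n : ℝ) + 1) := by
        intro n Y hY
        rw [dist_eq_norm, hI, hI, ← Finset.sum_Ico_consecutive _ (show 1 ≤ n + 1 by omega)
          (show n + 1 ≤ Y + 1 by omega), add_sub_cancel_left]
        have := abel_tail c N hK (n + 1) (Y + 1) (by omega) (by omega)
        push_cast at this
        exact this
      intro n m k hn hm
      calc _ ≤ _ := dist_triangle_right _ _ (∑ m ∈ Finset.Ioc 0 k, c m / (m : ℂ))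
        _ ≤ _ := add_le_add (tail k n hn) (tail k m hm)
        _ = _ := by ring
    · have : Tendsto (fun n : ℕ => 4 * (N : ℝ) * (1 / ((n : ℝ) + 1))) atTop (nhds (4 * (N : ℝ) * 0)) :=
        tendsto_one_div_add_atTop_nhds_zero_nat.const_mul _
      rw [mul_zero] at this
      refine this.congr fun n => by ring
  · intro X
    rcases le_or_gt X N with h | h
    · linarith [small X h]
    · rw [hI, ← Finset.sum_Ico_consecutive _ (show 1 ≤ N + 1 by omega)
          (show N + 1 ≤ X + 1 by omega), ← hI]
      have h1 := abel_tail c N hK (N + 1) (X + 1) (by omega) (by omega)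
      have h2 : 2 * (N : ℝ) / ((N + 1 : ℕ) : ℝ) ≤ 2 := by
        rw [div_le_iff₀ (by positivity)]; push_cast; linarith
      calc _ ≤ _ := norm_add_le _ _
        _ ≤ (1 + Real.log N) + 2 := add_le_add (small N le_rfl) (h1.trans h2)
        _ = _ := by ring

/-! ### Part 3: the quadratic character -/

lemma jac_one_of_mod (B : ℤ) (hB : B ≠ 0) (n : ℕ) (hn : n % (8 * B.natAbs) = 1) :
    jacobiSym B n = 1 := by
  have h0 : 0 < B.natAbs := Int.natAbs_pos.mpr hB
  have h4 : n % (4 * B.natAbs) = 1 := by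
    have h := Nat.mod_mod_of_dvd n (show 4 * B.natAbs ∣ 8 * B.natAbs from ⟨2, by ring⟩)
    rw [← h, hn]
    exact Nat.mod_eq_of_lt (by omega)
  have hodd : Odd n := by
    have h := Nat.mod_mod_of_dvd n (show 2 ∣ 8 * B.natAbs from ⟨4 * B.natAbs, by ring⟩)
    rw [Nat.odd_iff, ← h, hn]
  rw [jacobiSym.mod_right B hodd, h4, jacobiSym.one_right]

lemma jac_case_odd_prime (p : ℕ) (hp : p.Prime) (hp2 : p ≠ 2) (i : ℕ) (B : ℤ) (hB : B ≠ 0)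
    (hpB : ¬ (p : ℤ) ∣ B) : ∃ n : ℕ, Odd n ∧ jacobiSym ((p : ℤ) ^ (2 * i + 1) * B) n = -1 := by
  have : Fact p.Prime := ⟨hp⟩
  have h0 : 0 < B.natAbs := Int.natAbs_pos.mpr hB
  have hcop : Nat.Coprime (8 * B.natAbs) p := by
    apply Nat.Coprime.mul_left
    · have : Nat.Coprime 2 p := (Nat.coprime_primes Nat.prime_two hp).mpr hp2.symm
      exact Nat.Coprime.pow_left 3 this
    · rw [Nat.coprime_comm, Nat.Prime.coprime_iff_not_dvd hp]
      intro h
      exact hpB (Int.natCast_dvd.mpr h)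
  obtain ⟨r, hr⟩ := quadraticChar_exists_neg_one (F := ZMod p) (by rwa [ZMod.ringChar_zmod_n])
  obtain ⟨n, hn1, hn2⟩ := Nat.chineseRemainder hcop 1 r.val
  have hn1' : n % (8 * B.natAbs) = 1 := by
    rw [hn1]; exact Nat.mod_eq_of_lt (by omega)
  have hn4 : n % 4 = 1 := by
    have h := Nat.mod_mod_of_dvd n (show 4 ∣ 8 * B.natAbs from ⟨2 * B.natAbs, by ring⟩)
    rw [← h, hn1']
  have hodd : Odd n := by rw [Nat.odd_iff]; omega
  refine ⟨n, hodd, ?_⟩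
  have hpodd : Odd p := hp.odd_of_ne_two hp2
  rw [jacobiSym.mul_left, jac_one_of_mod B hB n hn1', mul_one, jacobiSym.pow_left,
    jacobiSym.quadratic_reciprocity_one_mod_four' hpodd hn4, ← jacobiSym.legendreSym.to_jacobiSym]
  have : legendreSym p (n : ℤ) = -1 := by
    unfold legendreSym
    have : ((n : ℤ) : ZMod p) = r := by
      have := (ZMod.natCast_eq_natCast_iff n r.val p).mpr hn2
      simpa using this
    rw [this, hr]
  rw [this]
  exact Odd.neg_one_pow ⟨i, rfl⟩

lemma exists_jac_neg_one (A : ℤ) (hA0 : A ≠ 0) (hA : ¬ IsSquare A) :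
    ∃ n : ℕ, Odd n ∧ jacobiSym A n = -1 := by
  obtain ⟨s, b, hsb, hs⟩ := Nat.sq_mul_squarefree A.natAbs
  have hb0 : b ≠ 0 := by rintro rfl; simp at hsb; exact hA0 (Int.natAbs_eq_zero.mp hsb.symm)
  have hs0 : s ≠ 0 := hs.ne_zero
  by_cases hodd : ∃ p : ℕ, p.Prime ∧ p ≠ 2 ∧ p ∣ s
  · obtain ⟨p, hp, hp2, hps⟩ := hodd
    obtain ⟨s', rfl⟩ := hps
    have hps' : ¬ p ∣ s' := by
      rintro ⟨t, rfl⟩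
      have := hs p ⟨t, by ring⟩
      exact hp.one_lt.ne' (Nat.isUnit_iff.mp this)
    obtain ⟨i, b', hpb', rfl⟩ := Nat.exists_eq_pow_mul_and_not_dvd hb0 p hp.ne_one
    have hB : ∃ B : ℤ, B.natAbs = b' ^ 2 * s' ∧ A = (p : ℤ) ^ (2 * i + 1) * B := by
      rcases Int.natAbs_eq A with h | h
      · refine ⟨(b' ^ 2 * s' : ℕ), by simp [Int.natAbs_mul, Int.natAbs_pow], ?_⟩
        rw [h, ← hsb]; push_cast; ring
      · refine ⟨-(b' ^ 2 * s' : ℕ), by simp [Int.natAbs_mul, Int.natAbs_pow], ?_⟩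
        rw [h, ← hsb]; push_cast; ring
    obtain ⟨B, hBabs, hAB⟩ := hB
    rw [hAB]
    apply jac_case_odd_prime p hp hp2 i B
    · rintro rfl; simp at hAB; exact hA0 hAB
    · rw [Int.natCast_dvd, hBabs]
      intro h
      rcases hp.dvd_mul.mp h with h | h
      · exact hpb' (hp.dvd_of_dvd_pow h)
      · exact hps' h
  · push Not at hodd
    have hs2 : s = 1 ∨ s = 2 := by
      have h := Nat.eq_prime_pow_of_unique_prime_dvd (p := 2) hs0 (fun {d} hd hds => by
        by_contra hne
        exact hodd d hd hne hds)
      set e := s.primeFactorsList.length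
      rcases Nat.lt_or_ge e 2 with he | he
      · interval_cases e
        · left; simpa using h
        · right; simpa using h
      · exfalso
        have := hs 2 (by rw [h]; exact ⟨2 ^ (e - 2), by rw [← pow_two, ← pow_add]; congr 1; omega⟩)
        simp at this
    obtain ⟨i, m, hm, rfl⟩ := Nat.exists_eq_pow_mul_and_not_dvd hb0 2 (by norm_num)
    have hmodd : m % 2 = 1 := by omega
    have hm0 : 0 < m := by omega
    have hm8 : m ^ 2 % 8 = 1 := by
      have : m % 8 = 1 ∨ m % 8 = 3 ∨ m % 8 = 5 ∨ m % 8 = 7 := by omega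
      rcases this with h | h | h | h <;> simp [Nat.pow_mod, h]
    have hsq : ∀ n : ℕ, Odd n → Nat.Coprime m n →
        jacobiSym (((2 ^ i * m : ℕ) : ℤ) ^ 2) n = 1 := by
      intro n hn hmn
      apply jacobiSym.sq_one'
      rw [Int.gcd_natCast_natCast]
      exact Nat.Coprime.mul_left (Nat.Coprime.pow_left _ (Nat.coprime_two_left.mpr hn)) hmn
    have hn5odd : Odd (4 * m ^ 2 + 1) := ⟨2 * m ^ 2, by ring⟩
    have hn5cop : Nat.Coprime m (4 * m ^ 2 + 1) := by
      have : 4 * m ^ 2 + 1 = 1 + m * (4 * m) := by ring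
      rw [this, Nat.coprime_add_mul_left_right]; simp
    have hn3odd : Odd (4 * m ^ 2 - 1) := by
      have : 0 < m ^ 2 := by positivity
      exact ⟨2 * m ^ 2 - 1, by omega⟩
    have hn3cop : Nat.Coprime m (4 * m ^ 2 - 1) := by
      have : 0 < m ^ 2 := by positivity
      rw [← Nat.isCoprime_iff_coprime]
      refine ⟨4 * m, -1, ?_⟩
      rw [Nat.cast_sub (by omega)]
      push_cast; ring
    have h5 : (4 * m ^ 2 + 1) % 8 = 5 := by omega
    have h3 : (4 * m ^ 2 - 1) % 4 = 3 := by omega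
    rcases hs2 with rfl | rfl
    · rcases Int.natAbs_eq A with h | h
      · exfalso
        apply hA
        rw [h, ← hsb]
        exact ⟨((2 ^ i * m : ℕ) : ℤ), by push_cast; ring⟩
      · refine ⟨4 * m ^ 2 - 1, hn3odd, ?_⟩
        have : A = -1 * ((2 ^ i * m : ℕ) : ℤ) ^ 2 := by rw [h, ← hsb]; push_cast; ring
        rw [this, jacobiSym.mul_left, hsq _ hn3odd hn3cop, mul_one, jacobiSym.at_neg_one hn3odd]
        exact ZMod.χ₄_nat_three_mod_four h3
    · refine ⟨4 * m ^ 2 + 1, hn5odd, ?_⟩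
      have hc : ((4 * m ^ 2 + 1 : ℕ) : ZMod 8) = 5 := by
        have := (ZMod.natCast_eq_natCast_iff (4 * m ^ 2 + 1) 5 8).mpr h5
        simpa using this
      rcases Int.natAbs_eq A with h | h
      · have : A = 2 * ((2 ^ i * m : ℕ) : ℤ) ^ 2 := by rw [h, ← hsb]; push_cast; ring
        rw [this, jacobiSym.mul_left, hsq _ hn5odd hn5cop, mul_one, jacobiSym.at_two hn5odd, hc]
        decide
      · have : A = -2 * ((2 ^ i * m : ℕ) : ℤ) ^ 2 := by rw [h, ← hsb]; push_cast; ring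
        rw [this, jacobiSym.mul_left, hsq _ hn5odd hn5cop, mul_one, jacobiSym.at_neg_two hn5odd, hc]
        decide

/-- The quadratic character `m ↦ (A/m)`, extended by zero to even `m`. -/
noncomputable def qch (A : ℤ) (m : ℕ) : ℤ := if Odd m then jacobiSym A m else 0

lemma qch_mul (A : ℤ) (m n : ℕ) : qch A (m * n) = qch A m * qch A n := by
  unfold qch
  by_cases hm : Odd m <;> by_cases hn : Odd n <;> simp [Nat.odd_mul, hm, hn]
  exact jacobiSym.mul_right' A hm.pos.ne' hn.pos.ne'

lemma qch_abs_le (A : ℤ) (m : ℕ) : |qch A m| ≤ 1 := by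
  unfold qch
  split_ifs
  · rcases jacobiSym.trichotomy A m with h | h | h <;> simp [h]
  · simp

lemma qch_mod (A : ℤ) (m : ℕ) : qch A (m % (4 * A.natAbs)) = qch A m := by
  have h2 : Odd (m % (4 * A.natAbs)) ↔ Odd m := by
    have h := Nat.mod_mod_of_dvd m (show 2 ∣ 4 * A.natAbs from ⟨2 * A.natAbs, by ring⟩)
    rw [Nat.odd_iff, Nat.odd_iff, h]
  unfold qch
  by_cases hm : Odd m
  · rw [if_pos hm, if_pos (h2.mpr hm), ← jacobiSym.mod_right A hm]
  · rw [if_neg hm, if_neg (fun h => hm (h2.mp h))]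

lemma qch_sum (A : ℤ) (hA0 : A ≠ 0) (hA : ¬ IsSquare A) :
    ∑ n ∈ Finset.range (4 * A.natAbs), (qch A n : ℂ) = 0 := by
  have h0 : 0 < A.natAbs := Int.natAbs_pos.mpr hA0
  set N := 4 * A.natAbs with hN
  have : NeZero N := ⟨by omega⟩
  obtain ⟨n, hodd, hn⟩ := exists_jac_neg_one A hA0 hA
  have hgcd : Nat.Coprime n N := by
    apply Nat.Coprime.mul_right
    · have : Nat.Coprime n 2 := Nat.coprime_two_right.mpr hodd
      exact Nat.Coprime.pow_right 2 this
    · by_contra hne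
      have : jacobiSym A n = 0 := by
        rw [jacobiSym.eq_zero_iff]
        refine ⟨hodd.pos.ne', ?_⟩
        rw [Int.gcd_eq_natAbs, Int.natAbs_natCast, Nat.gcd_comm]
        exact hne
      rw [this] at hn; norm_num at hn
  have hqn : qch A n = -1 := by simp [qch, hodd, hn]
  let u : (ZMod N)ˣ := ZMod.unitOfCoprime n hgcd
  have hsum : ∑ n ∈ Finset.range N, (qch A n : ℂ) = ∑ x : ZMod N, (qch A x.val : ℂ) := by
    refine Finset.sum_bij' (fun n _ => (n : ZMod N)) (fun x _ => x.val) ?_ ?_ ?_ ?_ ?_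
    · simp
    · intro x _; simpa using ZMod.val_lt x
    · intro k hk; exact ZMod.val_cast_of_lt (Finset.mem_range.mp hk)
    · intro x _; simp
    · intro k hk; rw [ZMod.val_cast_of_lt (Finset.mem_range.mp hk)]
  have h1 : ∑ x : ZMod N, (qch A x.val : ℂ) = -∑ x : ZMod N, (qch A x.val : ℂ) := by
    calc ∑ x : ZMod N, (qch A x.val : ℂ) = ∑ x : ZMod N, (qch A ((u : ZMod N) * x).val : ℂ) :=
          (Equiv.sum_comp (Units.mulLeft u) (fun x : ZMod N => (qch A x.val : ℂ))).symm
      _ = ∑ x : ZMod N, (-(qch A x.val : ℂ)) := by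
          apply Finset.sum_congr rfl
          intro x _
          have : ((u : ZMod N) * x).val = (n * x.val) % N := by
            rw [ZMod.val_mul]
            simp [u, ZMod.val_natCast, Nat.mod_mul_mod]
          rw [this, show qch A (n * x.val % N) = qch A (n * x.val) from qch_mod A _, qch_mul, hqn]
          push_cast; ring
      _ = _ := by rw [Finset.sum_neg_distrib]
  rw [hsum]
  have h2 : (2 : ℂ) * ∑ x : ZMod N, (qch A x.val : ℂ) = 0 := by
    linear_combination h1
  simpa using h2

lemma qch_series (A : ℤ) (hA0 : A ≠ 0) (hA : ¬ IsSquare A) :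
    (∃ L : ℂ, Tendsto (fun X : ℕ => ∑ m ∈ Finset.Ioc 0 X, (qch A m : ℂ) / (m : ℂ)) atTop (nhds L)) ∧
      ∀ X : ℕ, ‖∑ m ∈ Finset.Ioc 0 X, (qch A m : ℂ) / (m : ℂ)‖
        ≤ 3 + Real.log ((4 * A.natAbs : ℕ) : ℝ) := by
  have h0 : 0 < A.natAbs := Int.natAbs_pos.mpr hA0
  refine char_series (fun m => (qch A m : ℂ)) (4 * A.natAbs) (by omega) ?_ ?_ (qch_sum A hA0 hA)
  · intro n
    rw [Complex.norm_intCast]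
    exact_mod_cast qch_abs_le A n
  · intro n
    rw [← qch_mod A (n + _), Nat.add_mod_right, qch_mod]

/-! ### Part 4: elementary estimates -/

lemma omega_bound (C : ℝ) (hC : 1 ≤ C) (η : ℝ) (hη : 0 < η) :
    ∃ K : ℝ, 0 < K ∧ ∀ n : ℕ, n ≠ 0 → C ^ n.primeFactors.card ≤ K * (n : ℝ) ^ η := by
  obtain ⟨P, hP⟩ := exists_nat_ge (C ^ (1 / η))
  refine ⟨C ^ P, by positivity, ?_⟩
  intro n hn
  have hC0 : 0 ≤ C := by linarith
  calc C ^ n.primeFactors.card = ∏ p ∈ n.primeFactors, C := by simp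
    _ ≤ ∏ p ∈ n.primeFactors, ((if p < P then C else 1) * (p : ℝ) ^ η) := by
        apply Finset.prod_le_prod
        · intros; exact hC0
        · intro p hp
          have hp1 : (1 : ℝ) ≤ p := by exact_mod_cast (Nat.prime_of_mem_primeFactors hp).one_lt.le
          split_ifs with h
          · exact le_mul_of_one_le_right hC0 (Real.one_le_rpow hp1 hη.le)
          · rw [one_mul]
            have hPp : (P : ℝ) ≤ p := by exact_mod_cast not_lt.mp h
            calc C = (C ^ (1 / η)) ^ η := by
                  rw [← Real.rpow_mul hC0, one_div, inv_mul_cancel₀ hη.ne', Real.rpow_one]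
              _ ≤ (p : ℝ) ^ η := by
                  apply Real.rpow_le_rpow (by positivity) (hP.trans hPp) hη.le
    _ = (∏ p ∈ n.primeFactors, if p < P then C else 1) * ∏ p ∈ n.primeFactors, (p : ℝ) ^ η :=
        Finset.prod_mul_distrib
    _ ≤ C ^ P * (n : ℝ) ^ η := by
        apply mul_le_mul
        · rw [← Finset.prod_filter, Finset.prod_const]
          apply pow_le_pow_right₀ hC
          calc _ ≤ (Finset.range P).card := by
                apply Finset.card_le_card
                intro p hp
                simpa using (Finset.mem_filter.mp hp).2
            _ = P := by simp
        · rw [Real.finsetProd_rpow _ _ (fun _ _ => by positivity)]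
          apply Real.rpow_le_rpow (Finset.prod_nonneg fun _ _ => by positivity) _ hη.le
          rw [← Nat.cast_prod]
          exact_mod_cast Nat.le_of_dvd (Nat.pos_of_ne_zero hn) (Nat.prod_primeFactors_dvd n)
        · exact Finset.prod_nonneg fun _ _ => by positivity
        · positivity

lemma factored_sum (δ : ℝ) (hδ : 0 < δ) (s : Finset ℕ) (hs : ∀ p ∈ s, p.Prime) :
    Summable (fun n : ℕ => if n ∈ Nat.factoredNumbers s then (n : ℝ) ^ (-δ) else 0) ∧
      ∑' n : ℕ, (if n ∈ Nat.factoredNumbers s then (n : ℝ) ^ (-δ) else 0)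
        ≤ ((1 - (2 : ℝ) ^ (-δ))⁻¹) ^ s.card := by
  let f : ℕ →* ℝ :=
    { toFun := fun n => (n : ℝ) ^ (-δ)
      map_one' := by simp
      map_mul' := fun m n => by
        push_cast
        exact Real.mul_rpow (by positivity) (by positivity) }
  have hle : ∀ {p : ℕ}, p.Prime → f p ≤ (2 : ℝ) ^ (-δ) := by
    intro p hp
    have h2 : (2 : ℝ) ≤ p := by exact_mod_cast hp.two_le
    exact Real.rpow_le_rpow_of_nonpos (by norm_num) h2 (by linarith)
  have h21 : (2 : ℝ) ^ (-δ) < 1 := Real.rpow_lt_one_of_one_lt_of_neg (by norm_num) (by linarith)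
  have hnn : ∀ n, 0 ≤ f n := fun n => Real.rpow_nonneg (by positivity) _
  have h := EulerProduct.summable_and_hasSum_factoredNumbers_prod_filter_prime_geometric (f := f)
    (fun {p} hp => by
      rw [Real.norm_of_nonneg (hnn p)]
      exact (hle hp).trans_lt h21) s
  have hind : (fun n : ℕ => if n ∈ Nat.factoredNumbers s then (n : ℝ) ^ (-δ) else 0)
      = Set.indicator (Nat.factoredNumbers s) f := by
    ext n
    by_cases hn : n ∈ Nat.factoredNumbers s
    · rw [if_pos hn, Set.indicator_of_mem hn]; rfl
    · rw [if_neg hn, Set.indicator_of_notMem hn]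
  have hsum : HasSum (Set.indicator (Nat.factoredNumbers s) f)
      (∏ p ∈ s with p.Prime, (1 - f p)⁻¹) := hasSum_subtype_iff_indicator.mp h.2
  rw [hind]
  refine ⟨hsum.summable, ?_⟩
  rw [hsum.tsum_eq, Finset.filter_true_of_mem hs, ← Finset.prod_const]
  apply Finset.prod_le_prod
  · intro p hp
    have := (hle (hs p hp)).trans_lt h21
    exact inv_nonneg.mpr (by linarith)
  · intro p hp
    have := (hle (hs p hp))
    exact inv_anti₀ (by linarith) (by linarith)

lemma gcd_delta (a : Fin 4 → ℤ) (ha : ∀ i, a i ≠ 0) (q : ℕ) (hq : 0 < q) :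
    (∏ i, Int.gcd (a i) q) ^ 2 ≤ q ^ 4 * Delta4 a := by
  have pair : ∀ x y : ℤ, x ≠ 0 → Int.gcd x q * Int.gcd y q ≤ q * Int.gcd x y := by
    intro x y hx
    rw [← Nat.gcd_mul_lcm]
    have h1 : Nat.gcd (Int.gcd x q) (Int.gcd y q) ∣ Int.gcd x y := by
      apply Int.dvd_gcd
      · exact (Int.natCast_dvd_natCast.mpr (Nat.gcd_dvd_left _ _)).trans (Int.gcd_dvd_left ..)
      · exact (Int.natCast_dvd_natCast.mpr (Nat.gcd_dvd_right _ _)).trans (Int.gcd_dvd_left ..)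
    have h2 : Nat.lcm (Int.gcd x q) (Int.gcd y q) ∣ q := by
      apply Nat.lcm_dvd <;> exact Int.natCast_dvd_natCast.mp (Int.gcd_dvd_right ..)
    rw [mul_comm q]
    exact Nat.mul_le_mul (Nat.le_of_dvd (Int.gcd_pos_of_ne_zero_left _ hx) h1)
      (Nat.le_of_dvd hq h2)
  have comp : ∀ i j : Fin 4, j ≠ i →
      Int.gcd (a i) (a j) ≤ Int.gcd (a i) (∏ j ∈ Finset.univ.erase i, a j) := by
    intro i j hij
    apply Nat.le_of_dvd (Int.gcd_pos_of_ne_zero_left _ (ha i))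
    apply Int.dvd_gcd
    · exact Int.gcd_dvd_left ..
    · exact (Int.gcd_dvd_right ..).trans
        (Finset.dvd_prod_of_mem a (Finset.mem_erase.mpr ⟨hij, Finset.mem_univ _⟩))
  unfold Delta4
  rw [Fin.prod_univ_four, Fin.prod_univ_four]
  have c01 := comp 0 1 (by decide)
  have c10 := comp 1 0 (by decide)
  have c23 := comp 2 3 (by decide)
  have c32 := comp 3 2 (by decide)
  rw [Int.gcd_comm (a 1) (a 0)] at c10
  rw [Int.gcd_comm (a 3) (a 2)] at c32
  have p01 := pair (a 0) (a 1) (ha 0)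
  have p23 := pair (a 2) (a 3) (ha 2)
  calc _ = ((Int.gcd (a 0) q * Int.gcd (a 1) q) * (Int.gcd (a 2) q * Int.gcd (a 3) q)) ^ 2 := by
          ring
    _ ≤ ((q * Int.gcd (a 0) (a 1)) * (q * Int.gcd (a 2) (a 3))) ^ 2 :=
          Nat.pow_le_pow_left (Nat.mul_le_mul p01 p23) 2
    _ = q ^ 4 * (Int.gcd (a 0) (a 1) * Int.gcd (a 0) (a 1) * Int.gcd (a 2) (a 3)
          * Int.gcd (a 2) (a 3)) := by ring
    _ ≤ _ := by gcongr

/-- Interpolation between the two bounds for `q⁻¹ ∏ gcd(aᵢ,q)^{1/2}`. -/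
lemma gcd_interp (a : Fin 4 → ℤ) (ha : ∀ i, a i ≠ 0) (q : ℕ) (hq : 0 < q) (δ : ℝ) (hδ : 0 < δ)
    (hδ1 : δ ≤ 1) :
    (q : ℝ)⁻¹ * Real.sqrt ((∏ i, Int.gcd (a i) q : ℕ) : ℝ)
      ≤ (Delta4 a : ℝ) ^ ((1 : ℝ) / 4) * ((∏ i, a i).natAbs : ℝ) ^ (δ / 2) * (q : ℝ) ^ (-δ) := by
  set X : ℝ := (q : ℝ)⁻¹ * Real.sqrt ((∏ i, Int.gcd (a i) q : ℕ) : ℝ) with hX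
  have hq0 : (0 : ℝ) < q := by exact_mod_cast hq
  have hX0 : 0 ≤ X := by positivity
  have hD1 : (1 : ℝ) ≤ Delta4 a := by
    have : 0 < Delta4 a :=
      Finset.prod_pos fun i _ => Int.gcd_pos_of_ne_zero_left _ (ha i)
    exact_mod_cast this
  have hP : X ≤ (Delta4 a : ℝ) ^ ((1 : ℝ) / 4) := by
    have h4 : X ^ (4 : ℕ) ≤ Delta4 a := by
      have h := gcd_delta a ha q hq
      have h' : (((∏ i, Int.gcd (a i) q : ℕ) : ℝ)) ^ 2 ≤ (q : ℝ) ^ 4 * Delta4 a := by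
        exact_mod_cast h
      have hs : Real.sqrt ((∏ i, Int.gcd (a i) q : ℕ) : ℝ) ^ 4
          = ((∏ i, Int.gcd (a i) q : ℕ) : ℝ) ^ 2 := by
        have hp4 : ∀ x : ℝ, x ^ 4 = (x ^ 2) ^ 2 := fun x => by ring
        rw [hp4, Real.sq_sqrt (by positivity)]
      rw [hX, mul_pow, hs, inv_pow, inv_mul_le_iff₀ (by positivity)]
      exact h'
    calc X = (X ^ (4 : ℕ)) ^ ((1 : ℝ) / 4) := by
          rw [← Real.rpow_natCast, ← Real.rpow_mul hX0]; norm_num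
      _ ≤ _ := Real.rpow_le_rpow (by positivity) h4 (by norm_num)
  have hQ : X ≤ (q : ℝ)⁻¹ * ((∏ i, a i).natAbs : ℝ) ^ ((1 : ℝ) / 2) := by
    rw [hX, ← Real.sqrt_eq_rpow]
    gcongr
    rw [show (∏ i, a i).natAbs = ∏ i, (a i).natAbs from map_prod Int.natAbsHom a _]
    apply Finset.prod_le_prod'
    intro i _
    exact Nat.le_of_dvd (Int.natAbs_pos.mpr (ha i)) (Int.gcd_dvd_natAbs_left ..)
  have hD4 : (1 : ℝ) ≤ (Delta4 a : ℝ) ^ ((1 : ℝ) / 4) := Real.one_le_rpow hD1 (by norm_num)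
  calc X = X ^ (1 - δ) * X ^ δ := by
        rcases hX0.eq_or_lt with h | h
        · rw [← h, Real.zero_rpow hδ.ne', mul_zero]
        · rw [← Real.rpow_add h]; simp
    _ ≤ ((Delta4 a : ℝ) ^ ((1 : ℝ) / 4)) ^ (1 - δ)
        * ((q : ℝ)⁻¹ * ((∏ i, a i).natAbs : ℝ) ^ ((1 : ℝ) / 2)) ^ δ := by
        gcongr
    _ ≤ ((Delta4 a : ℝ) ^ ((1 : ℝ) / 4)) ^ (1 : ℝ)
        * ((q : ℝ)⁻¹ * ((∏ i, a i).natAbs : ℝ) ^ ((1 : ℝ) / 2)) ^ δ := by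
        gcongr
        linarith
    _ = _ := by
        rw [Real.rpow_one, Real.mul_rpow (by positivity) (by positivity), ← Real.rpow_mul
          (by positivity), Real.inv_rpow hq0.le, ← Real.rpow_neg hq0.le]
        ring_nf

lemma log_bound (η : ℝ) (hη : 0 < η) :
    ∃ K : ℝ, 0 < K ∧ ∀ n : ℕ, n ≠ 0 → 3 + Real.log ((4 * n : ℕ) : ℝ) ≤ K * (n : ℝ) ^ η := by
  refine ⟨3 + Real.log 4 + 1 / η, ?_, ?_⟩
  · have : 0 ≤ Real.log 4 := Real.log_nonneg (by norm_num)
    positivity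
  · intro n hn
    have hn1 : (1 : ℝ) ≤ n := by exact_mod_cast Nat.one_le_iff_ne_zero.mpr hn
    have h4 : 0 ≤ Real.log 4 := Real.log_nonneg (by norm_num)
    have h1 := Real.log_le_rpow_div (by linarith : (0 : ℝ) ≤ n) hη
    have h2 := Real.one_le_rpow hn1 hη.le
    push_cast
    rw [Real.log_mul (by norm_num) (by positivity)]
    have h3 : 3 + Real.log 4 ≤ (3 + Real.log 4) * (n : ℝ) ^ η := le_mul_of_one_le_right (by linarith) h2
    calc _ ≤ (3 + Real.log 4) * (n : ℝ) ^ η + (n : ℝ) ^ η / η := by linarith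
      _ = _ := by ring

/-! ### Part 5: Gauss sums -/

/-- The quadratic Gauss sum over `ZMod q`. -/
noncomputable def GS (q : ℕ) [NeZero q] (t : ZMod q) : ℂ :=
  ∑ b : ZMod q, ZMod.stdAddChar (t * b ^ 2)

/-- The complete exponential sum, as a sum of products of Gauss sums. -/
noncomputable def SS (q : ℕ) [NeZero q] (a : Fin 4 → ℤ) : ℂ :=
  ∑ u : (ZMod q)ˣ, ∏ i, GS q ((u : ZMod q) * (a i : ZMod q))

lemma sum_range_zmod (q : ℕ) [NeZero q] (h : ZMod q → ℂ) :
    ∑ b ∈ Finset.range q, h (b : ZMod q) = ∑ x : ZMod q, h x := by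
  refine Finset.sum_bij' (fun n _ => (n : ZMod q)) (fun x _ => x.val) ?_ ?_ ?_ ?_ ?_
  · simp
  · intro x _; simpa using ZMod.val_lt x
  · intro k hk; exact ZMod.val_cast_of_lt (Finset.mem_range.mp hk)
  · intro x _; simp
  · intro k hk; rfl

lemma sum_coprime_zmod (q : ℕ) [NeZero q] (h : ZMod q → ℂ) :
    ∑ k ∈ (Finset.range q).filter (fun k => Nat.gcd k q = 1), h (k : ZMod q)
      = ∑ u : (ZMod q)ˣ, h (u : ZMod q) := by
  refine Finset.sum_bij' (fun n hn => ZMod.unitOfCoprime n (Finset.mem_filter.mp hn).2)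
    (fun x _ => (x : ZMod q).val) ?_ ?_ ?_ ?_ ?_
  · simp
  · intro x _
    rw [Finset.mem_filter, Finset.mem_range]
    exact ⟨ZMod.val_lt _, ZMod.val_coe_unit_coprime x⟩
  · intro k hk
    rw [ZMod.coe_unitOfCoprime]
    exact ZMod.val_cast_of_lt (Finset.mem_range.mp (Finset.mem_filter.mp hk).1)
  · intro x _; ext; simp
  · intro k hk; rw [ZMod.coe_unitOfCoprime]

lemma eC_int (q : ℕ) [NeZero q] (j : ℤ) :
    eC ((j : ℝ) / (q : ℝ)) = ZMod.stdAddChar (j : ZMod q) := by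
  rw [ZMod.stdAddChar_coe, eC]
  congr 1
  push_cast
  ring

lemma Sqa_eq (a : Fin 4 → ℤ) (q : ℕ) [NeZero q] : Sqa a 0 q = SS q a := by
  unfold Sqa SS
  rw [← sum_coprime_zmod q (fun u => ∏ i, GS q (u * (a i : ZMod q)))]
  refine Finset.sum_congr (by congr) fun k _ => ?_
  have : ∀ i, GS q ((k : ZMod q) * (a i : ZMod q))
      = ∑ b ∈ Finset.range q, ZMod.stdAddChar (((k : ZMod q) * (a i : ZMod q)) * (b : ZMod q) ^ 2) :=
    fun i => (sum_range_zmod q (fun b => ZMod.stdAddChar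
      (((k : ZMod q) * (a i : ZMod q)) * b ^ 2))).symm
  simp_rw [this]
  rw [Finset.prod_univ_sum]
  refine Finset.sum_congr rfl fun b _ => ?_
  rw [eC_int q]
  simp only [Fin.prod_univ_four, Fin.sum_univ_four, ← AddChar.map_add_eq_mul]
  congr 1
  push_cast
  simp only [Pi.zero_apply, Int.cast_zero, mul_zero, add_zero]
  ring

lemma card_kernel (q : ℕ) [NeZero q] (c : ℤ) :
    (Finset.univ.filter fun h : ZMod q => h * (c : ZMod q) = 0).card ≤ Int.gcd c q := by
  have hpos : 0 < Int.gcd c q :=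
    Int.gcd_pos_of_ne_zero_right _ (by exact_mod_cast NeZero.ne q)
  refine le_trans (Finset.card_le_card ?_) (IsAddCyclic.card_nsmul_eq_zero_le (α := ZMod q) hpos)
  intro h hh
  simp only [Finset.mem_filter, Finset.mem_univ, true_and] at hh ⊢
  rw [nsmul_eq_mul]
  have hb := Int.gcd_eq_gcd_ab c q
  have hb' : ((Int.gcd c q : ℕ) : ZMod q) = (c : ZMod q) * (Int.gcdA c q : ZMod q) := by
    have := congrArg (Int.cast : ℤ → ZMod q) hb
    push_cast at this
    simpa using this
  rw [hb']
  linear_combination (Int.gcdA c q : ZMod q) * hh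

lemma GS_mul_conj (q : ℕ) [NeZero q] (t : ZMod q) :
    GS q t * (starRingEnd ℂ) (GS q t)
      = ∑ h : ZMod q, ZMod.stdAddChar (t * h ^ 2) * (if h * (2 * t) = 0 then (q : ℂ) else 0) := by
  have hprim := ZMod.isPrimitive_stdAddChar q
  calc GS q t * (starRingEnd ℂ) (GS q t)
      = ∑ c : ZMod q, ∑ b : ZMod q, ZMod.stdAddChar (t * b ^ 2 - t * c ^ 2) := by
        unfold GS
        rw [map_sum, Finset.sum_mul_sum, Finset.sum_comm]
        refine Finset.sum_congr rfl fun c _ => Finset.sum_congr rfl fun b _ => ?_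
        rw [← AddChar.map_neg_eq_conj, ← AddChar.map_add_eq_mul, sub_eq_add_neg]
    _ = ∑ c : ZMod q, ∑ h : ZMod q, ZMod.stdAddChar (t * (h + c) ^ 2 - t * c ^ 2) := by
        refine Finset.sum_congr rfl fun c _ => ?_
        exact (Equiv.sum_comp (Equiv.addRight c)
          (fun b : ZMod q => (ZMod.stdAddChar (t * b ^ 2 - t * c ^ 2) : ℂ))).symm
    _ = ∑ h : ZMod q, ZMod.stdAddChar (t * h ^ 2) * ∑ c : ZMod q,
          ZMod.stdAddChar (c * (h * (2 * t))) := by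
        rw [Finset.sum_comm]
        refine Finset.sum_congr rfl fun h _ => ?_
        rw [Finset.mul_sum]
        refine Finset.sum_congr rfl fun c _ => ?_
        rw [← AddChar.map_add_eq_mul]
        congr 1
        ring
    _ = _ := by
        refine Finset.sum_congr rfl fun h _ => ?_
        rw [AddChar.sum_mulShift _ hprim, ZMod.card]
        push_cast
        rfl

lemma GS_norm_sq (q : ℕ) [NeZero q] (u : (ZMod q)ˣ) (c : ℤ) (hc : c ≠ 0) :
    ‖GS q ((u : ZMod q) * (c : ZMod q))‖ ^ 2 ≤ 2 * q * (Int.gcd c q : ℝ) := by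
  have h1 := GS_mul_conj q ((u : ZMod q) * (c : ZMod q))
  rw [Complex.mul_conj] at h1
  have h2 : ‖GS q ((u : ZMod q) * (c : ZMod q))‖ ^ 2
      = ‖((Complex.normSq (GS q ((u : ZMod q) * (c : ZMod q))) : ℝ) : ℂ)‖ := by
    rw [Complex.norm_real, Complex.normSq_eq_norm_sq, Real.norm_of_nonneg (by positivity)]
  rw [h2, h1]
  have hg : (Int.gcd (2 * c) q : ℝ) ≤ 2 * (Int.gcd c q : ℝ) := by
    have hd : Int.gcd (2 * c) q ∣ 2 * Int.gcd c q := by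
      have := Int.gcd_dvd_gcd_mul_left_right (2 * c) q 2
      rw [Int.gcd_mul_left] at this
      simpa using this
    have hpos : 0 < 2 * Int.gcd c q := by
      have := Int.gcd_pos_of_ne_zero_left (q : ℤ) hc
      omega
    exact_mod_cast Nat.le_of_dvd hpos hd
  calc _ ≤ ∑ h : ZMod q, (if h * (2 * ((u : ZMod q) * (c : ZMod q))) = 0 then (q : ℝ) else 0) := by
        apply norm_sum_le_of_le
        intro h _
        rw [norm_mul, AddChar.norm_apply, one_mul]
        split_ifs <;> simp
    _ = ∑ h : ZMod q, (if h * ((2 * c : ℤ) : ZMod q) = 0 then (q : ℝ) else 0) := by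
        refine Finset.sum_congr rfl fun h _ => ?_
        have : h * (2 * ((u : ZMod q) * (c : ZMod q))) = 0 ↔ h * ((2 * c : ℤ) : ZMod q) = 0 := by
          push_cast
          rw [show h * (2 * ((u : ZMod q) * (c : ZMod q))) = u * (h * (2 * (c : ZMod q))) by ring]
          exact Units.mul_right_eq_zero u
        simp only [this]
    _ = q * (Finset.univ.filter fun h : ZMod q => h * ((2 * c : ℤ) : ZMod q) = 0).card := by
        rw [← Finset.sum_filter, Finset.sum_const, nsmul_eq_mul, mul_comm]
    _ ≤ q * (Int.gcd (2 * c) q : ℝ) := by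
        gcongr
        exact card_kernel q (2 * c)
    _ ≤ q * (2 * (Int.gcd c q : ℝ)) := by gcongr
    _ = _ := by ring

lemma SS_bound (a : Fin 4 → ℤ) (ha : ∀ i, a i ≠ 0) (q : ℕ) [NeZero q] :
    ‖SS q a‖ ≤ 4 * (q : ℝ) ^ 3 * Real.sqrt ((∏ i, Int.gcd (a i) q : ℕ) : ℝ) := by
  have h1 : ∀ u : (ZMod q)ˣ, ‖∏ i, GS q ((u : ZMod q) * (a i : ZMod q))‖
      ≤ 4 * (q : ℝ) ^ 2 * Real.sqrt ((∏ i, Int.gcd (a i) q : ℕ) : ℝ) := by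
    intro u
    have hsq : ‖∏ i, GS q ((u : ZMod q) * (a i : ZMod q))‖ ^ 2
        ≤ (4 * (q : ℝ) ^ 2) ^ 2 * ((∏ i, Int.gcd (a i) q : ℕ) : ℝ) := by
      rw [norm_prod, ← Finset.prod_pow]
      calc _ ≤ ∏ i, (2 * q * (Int.gcd (a i) q : ℝ)) :=
            Finset.prod_le_prod (fun _ _ => by positivity) fun i _ => GS_norm_sq q u (a i) (ha i)
        _ = _ := by
            rw [Finset.prod_mul_distrib]
            simp only [Finset.prod_const, Finset.card_univ, Fintype.card_fin]
            push_cast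
            ring
    have := Real.le_sqrt_of_sq_le hsq
    rwa [Real.sqrt_mul (by positivity), Real.sqrt_sq (by positivity)] at this
  calc ‖SS q a‖ ≤ ∑ u : (ZMod q)ˣ, 4 * (q : ℝ) ^ 2 * Real.sqrt ((∏ i, Int.gcd (a i) q : ℕ) : ℝ) :=
        norm_sum_le_of_le _ fun u _ => h1 u
    _ = (Nat.totient q : ℝ) * (4 * (q : ℝ) ^ 2 * Real.sqrt ((∏ i, Int.gcd (a i) q : ℕ) : ℝ)) := by
        rw [Finset.sum_const, Finset.card_univ, ZMod.card_units_eq_totient, nsmul_eq_mul]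
    _ ≤ (q : ℝ) * (4 * (q : ℝ) ^ 2 * Real.sqrt ((∏ i, Int.gcd (a i) q : ℕ) : ℝ)) := by
        gcongr
        exact Nat.totient_le q
    _ = _ := by ring

/-! Multiplicativity. -/

lemma std_mul (m n : ℕ) [NeZero m] [NeZero n] [NeZero (m * n)] (r s : ℤ)
    (hrs : r * n + s * m = 1) (h : Nat.Coprime m n) (x : ZMod (m * n)) :
    (ZMod.stdAddChar x : ℂ) = ZMod.stdAddChar ((r : ZMod m) * (ZMod.chineseRemainder h x).1)
      * ZMod.stdAddChar ((s : ZMod n) * (ZMod.chineseRemainder h x).2) := by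
  obtain ⟨j, rfl⟩ := ZMod.intCast_surjective x
  rw [map_intCast (ZMod.chineseRemainder h)]
  simp only [Prod.fst_intCast, Prod.snd_intCast]
  rw [← Int.cast_mul, ← Int.cast_mul, ZMod.stdAddChar_coe, ZMod.stdAddChar_coe,
    ZMod.stdAddChar_coe, ← Complex.exp_add]
  congr 1
  have hm : (m : ℂ) ≠ 0 := by exact_mod_cast NeZero.ne m
  have hn : (n : ℂ) ≠ 0 := by exact_mod_cast NeZero.ne n
  have hc : (r : ℂ) * n + s * m = 1 := by exact_mod_cast hrs
  push_cast
  field_simp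
  linear_combination (-(j : ℂ)) * hc

lemma GS_mul (m n : ℕ) [NeZero m] [NeZero n] [NeZero (m * n)] (r s : ℤ)
    (hrs : r * n + s * m = 1) (h : Nat.Coprime m n) (t : ZMod (m * n)) :
    GS (m * n) t = GS m ((r : ZMod m) * (ZMod.chineseRemainder h t).1)
      * GS n ((s : ZMod n) * (ZMod.chineseRemainder h t).2) := by
  unfold GS
  rw [Finset.sum_mul_sum, ← Fintype.sum_prod_type', ← Equiv.sum_comp
    (ZMod.chineseRemainder h).toEquiv]
  refine Finset.sum_congr rfl fun x _ => ?_
  rw [std_mul m n r s hrs h]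
  simp [mul_assoc]

lemma SS_mul (m n : ℕ) [NeZero m] [NeZero n] [NeZero (m * n)] (h : Nat.Coprime m n)
    (a : Fin 4 → ℤ) : SS (m * n) a = SS m a * SS n a := by
  obtain ⟨s, r, hrs⟩ := Nat.isCoprime_iff_coprime.mpr h
  have hrs' : r * n + s * m = 1 := by linarith
  have hr : IsUnit (r : ZMod m) := by
    have := congrArg (Int.cast : ℤ → ZMod m) hrs'
    push_cast at this
    rw [ZMod.natCast_self, mul_zero, add_zero] at this
    exact IsUnit.of_mul_eq_one _ this
  have hs : IsUnit (s : ZMod n) := by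
    have := congrArg (Int.cast : ℤ → ZMod n) hrs'
    push_cast at this
    rw [ZMod.natCast_self, mul_zero, zero_add] at this
    exact IsUnit.of_mul_eq_one _ this
  have em : SS m a = ∑ u : (ZMod m)ˣ, ∏ i, GS m ((r : ZMod m) * ((u : ZMod m) * (a i : ZMod m))) := by
    unfold SS
    rw [← Equiv.sum_comp (Equiv.mulLeft hr.unit)]
    simp [mul_assoc]
  have en : SS n a = ∑ u : (ZMod n)ˣ, ∏ i, GS n ((s : ZMod n) * ((u : ZMod n) * (a i : ZMod n))) := by
    unfold SS
    rw [← Equiv.sum_comp (Equiv.mulLeft hs.unit)]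
    simp [mul_assoc]
  rw [em, en, Finset.sum_mul_sum, ← Fintype.sum_prod_type']
  unfold SS
  let e : (ZMod (m * n))ˣ ≃* (ZMod m)ˣ × (ZMod n)ˣ :=
    (Units.mapEquiv (ZMod.chineseRemainder h).toMulEquiv).trans MulEquiv.prodUnits
  rw [← Equiv.sum_comp e.toEquiv]
  refine Finset.sum_congr rfl fun u _ => ?_
  rw [← Finset.prod_mul_distrib]
  refine Finset.prod_congr rfl fun i _ => ?_
  rw [GS_mul m n r s hrs' h, map_mul, map_intCast]
  rfl

/-! ### Part 6: evaluation at powers of good primes -/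

lemma sum_range_periodic (f : ℕ → ℂ) (m : ℕ) (hf : ∀ x, f (x + m) = f x) (n : ℕ) :
    ∑ x ∈ Finset.range (n * m), f x = n * ∑ x ∈ Finset.range m, f x := by
  have hf' : ∀ n x, f (n * m + x) = f x := by
    intro n
    induction n with
    | zero => simp
    | succ n ih => intro x; rw [← ih x, ← hf (n * m + x)]; congr 1; ring
  induction n with
  | zero => simp
  | succ n ih =>
    rw [Nat.succ_mul, Finset.sum_range_add, ih]
    simp_rw [hf' n]
    push_cast; ring

lemma sum_dvd_range (p r : ℕ) (hp : 0 < p) (f : ℕ → ℂ) :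
    ∑ x ∈ Finset.range (p * r), (if p ∣ x then f x else 0) = ∑ z ∈ Finset.range r, f (p * z) := by
  rw [← Finset.sum_filter]
  symm
  refine Finset.sum_bij (fun z _ => p * z) ?_ ?_ ?_ ?_
  · intro z hz
    rw [Finset.mem_filter, Finset.mem_range]
    exact ⟨Nat.mul_lt_mul_of_pos_left (Finset.mem_range.mp hz) hp, dvd_mul_right _ _⟩
  · intro x _ y _ hxy
    exact Nat.eq_of_mul_eq_mul_left hp hxy
  · intro x hx
    rw [Finset.mem_filter, Finset.mem_range] at hx
    obtain ⟨hx1, z, rfl⟩ := hx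
    exact ⟨z, Finset.mem_range.mpr (Nat.lt_of_mul_lt_mul_left hx1), rfl⟩
  · intros; rfl

lemma GS_rec (p : ℕ) [Fact p.Prime] (hp2 : p ≠ 2) (k : ℕ) (t : ℤ) (ht : ¬ (p : ℤ) ∣ t)
    [NeZero (p ^ (k + 2))] [NeZero (p ^ k)] :
    GS (p ^ (k + 2)) (t : ZMod (p ^ (k + 2))) = p * GS (p ^ k) (t : ZMod (p ^ k)) := by
  have hp : p.Prime := Fact.out
  set q := p ^ (k + 2) with hq
  have hprim := ZMod.isPrimitive_stdAddChar q
  have hqC : (q : ℂ) ≠ 0 := by exact_mod_cast NeZero.ne q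
  set R : ZMod q := ((p ^ (k + 1) : ℕ) : ZMod q) with hR
  have hRR : R * R = 0 := by
    rw [hR, ← Nat.cast_mul, ZMod.natCast_eq_zero_iff, hq, ← pow_add]
    exact pow_dvd_pow p (by omega)
  have h2t : IsUnit (2 * (t : ZMod q)) := by
    have h2 : IsUnit ((2 : ℕ) : ZMod q) := by
      rw [ZMod.isUnit_iff_coprime]
      exact Nat.Coprime.pow_right _ ((Nat.coprime_primes Nat.prime_two hp).mpr hp2.symm)
    have h3 : IsUnit (t : ZMod q) := by
      rw [ZMod.coe_int_isUnit_iff_isCoprime, hq]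
      push_cast
      apply IsCoprime.pow_left
      exact (Nat.prime_iff_prime_int.mp hp).irreducible.coprime_iff_not_dvd.mpr ht
    exact h2.mul h3
  have hker : ∀ x : ℕ, (x : ZMod q) * (2 * t * R) = 0 ↔ p ∣ x := by
    intro x
    rw [show (x : ZMod q) * (2 * t * R) = (2 * (t : ZMod q)) * (x * R) by ring,
      h2t.mul_right_eq_zero, hR, ← Nat.cast_mul, ZMod.natCast_eq_zero_iff, hq,
      show p ^ (k + 2) = p * p ^ (k + 1) by ring]
    exact Nat.mul_dvd_mul_iff_right (by have := hp.pos; positivity)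
  have step1 : GS q (t : ZMod q)
      = ∑ x : ZMod q, if x * (2 * (t : ZMod q) * R) = 0 then (ZMod.stdAddChar ((t : ZMod q) * x ^ 2) : ℂ) else 0 := by
    have h1 : ∀ y : ZMod q, GS q (t : ZMod q)
        = ∑ x : ZMod q, ZMod.stdAddChar ((t : ZMod q) * x ^ 2)
            * ZMod.stdAddChar (y * (x * (2 * (t : ZMod q) * R))) := by
      intro y
      unfold GS
      rw [← Equiv.sum_comp (Equiv.addRight (R * y))]
      refine Finset.sum_congr rfl fun x _ => ?_
      rw [← AddChar.map_add_eq_mul]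
      congr 1
      simp only [Equiv.coe_addRight]
      linear_combination (t : ZMod q) * y ^ 2 * hRR
    have h2 : (q : ℂ) * GS q (t : ZMod q) = ∑ y : ZMod q, GS q (t : ZMod q) := by
      rw [Finset.sum_const, Finset.card_univ, ZMod.card, nsmul_eq_mul]
    rw [Finset.sum_congr rfl fun y _ => h1 y, Finset.sum_comm] at h2
    apply mul_left_cancel₀ hqC
    rw [h2, Finset.mul_sum]
    refine Finset.sum_congr rfl fun x _ => ?_
    rw [← Finset.mul_sum, AddChar.sum_mulShift _ hprim, ZMod.card]
    split_ifs <;> simp [mul_comm]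
  rw [step1, ← sum_range_zmod]
  simp_rw [hker]
  rw [show Finset.range q = Finset.range (p * (p * p ^ k)) by rw [hq]; congr 1; ring,
    sum_dvd_range p (p * p ^ k) hp.pos (fun x => (ZMod.stdAddChar ((t : ZMod q) * (x : ZMod q) ^ 2) : ℂ))]
  have hpC : (p : ℂ) ≠ 0 := by exact_mod_cast hp.ne_zero
  have hF : ∀ z : ℕ, (ZMod.stdAddChar ((t : ZMod q) * ((p * z : ℕ) : ZMod q) ^ 2) : ℂ)
      = ZMod.stdAddChar ((t : ZMod (p ^ k)) * (z : ZMod (p ^ k)) ^ 2) := by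
    intro z
    have e1 : (t : ZMod q) * ((p * z : ℕ) : ZMod q) ^ 2 = ((t * (p * z) ^ 2 : ℤ) : ZMod q) := by
      push_cast; ring
    have e2 : (t : ZMod (p ^ k)) * (z : ZMod (p ^ k)) ^ 2 = ((t * z ^ 2 : ℤ) : ZMod (p ^ k)) := by
      push_cast; ring
    rw [e1, e2, ZMod.stdAddChar_coe, ZMod.stdAddChar_coe]
    congr 1
    rw [hq]
    push_cast
    field_simp
    ring
  simp_rw [hF]
  rw [sum_range_periodic (fun z => (ZMod.stdAddChar ((t : ZMod (p ^ k)) * (z : ZMod (p ^ k)) ^ 2) : ℂ))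
    (p ^ k) _ p, sum_range_zmod (p ^ k)
      (fun z => (ZMod.stdAddChar ((t : ZMod (p ^ k)) * z ^ 2) : ℂ))]
  · rfl
  · intro x
    rw [Nat.cast_add, ZMod.natCast_self, add_zero]

lemma GS_prime (p : ℕ) [Fact p.Prime] (hp2 : p ≠ 2) :
    ∃ g : ℂ, g ^ 4 = (p : ℂ) ^ 2 ∧ ∀ t : ℤ, ¬ (p : ℤ) ∣ t →
      GS p (t : ZMod p) = (jacobiSym t p : ℂ) * g := by
  have hp : p.Prime := Fact.out
  have hprim := ZMod.isPrimitive_stdAddChar p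
  have hchar : ringChar (ZMod p) ≠ 2 := by rwa [ZMod.ringChar_zmod_n]
  let χ : MulChar (ZMod p) ℂ := (quadraticChar (ZMod p)).ringHomComp (Int.castRingHom ℂ)
  have hχq : χ.IsQuadratic := (quadraticChar_isQuadratic (ZMod p)).comp _
  have hχ1 : χ ≠ 1 :=
    (MulChar.ringHomComp_ne_one_iff (Int.castRingHom ℂ).injective_int).mpr (quadraticChar_ne_one hchar)
  have hsq := gaussSum_sq hχ1 hχq hprim
  refine ⟨gaussSum χ ZMod.stdAddChar, ?_, ?_⟩
  · rw [show (4 : ℕ) = 2 * 2 by norm_num, pow_mul, hsq, mul_pow, ZMod.card,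
      ← map_pow]
    simp
  · intro t ht
    have ht0 : (t : ZMod p) ≠ 0 := by rwa [Ne, ZMod.intCast_zmod_eq_zero_iff_dvd]
    have hj : (jacobiSym t p : ℂ) = χ (t : ZMod p) := by
      rw [← jacobiSym.legendreSym.to_jacobiSym]; rfl
    have hshift := gaussSum_mulShift χ ZMod.stdAddChar (Units.mk0 (t : ZMod p) ht0)
    have hχt : χ (t : ZMod p) * χ (t : ZMod p) = 1 := by
      rw [← map_mul, ← pow_two]
      change ((quadraticChar (ZMod p) ((t : ZMod p) ^ 2) : ℤ) : ℂ) = 1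
      rw [quadraticChar_sq_one' ht0]; simp
    have hG : GS p (t : ZMod p) = gaussSum χ (ZMod.stdAddChar.mulShift (t : ZMod p)) := by
      unfold GS gaussSum
      have hfib : ∑ b : ZMod p, (ZMod.stdAddChar ((t : ZMod p) * b ^ 2) : ℂ)
          = ∑ n : ZMod p, (χ n + 1) * ZMod.stdAddChar ((t : ZMod p) * n) := by
        rw [← Finset.sum_fiberwise (s := Finset.univ) (g := fun b : ZMod p => b ^ 2)]
        refine Finset.sum_congr rfl fun n _ => ?_
        have hcard := quadraticChar_card_sqrts hchar n
        rw [Finset.sum_congr rfl (g := fun _ => (ZMod.stdAddChar ((t : ZMod p) * n) : ℂ))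
          (fun b hb => by rw [(Finset.mem_filter.mp hb).2]), Finset.sum_const, nsmul_eq_mul]
        congr 1
        have h2 : (Finset.univ.filter fun b : ZMod p => b ^ 2 = n) = {x : ZMod p | x ^ 2 = n}.toFinset := by
          ext; simp
        rw [h2]
        have := congrArg (Int.cast : ℤ → ℂ) hcard
        push_cast at this
        exact this
      rw [hfib]
      simp_rw [add_mul, one_mul]
      rw [Finset.sum_add_distrib]
      have h0 : ∑ n : ZMod p, (ZMod.stdAddChar ((t : ZMod p) * n) : ℂ) = 0 := by
        have := AddChar.sum_mulShift (t : ZMod p) hprim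
        simp only [ht0, if_false, Nat.cast_zero] at this
        rw [← this]
        exact Finset.sum_congr rfl fun n _ => by rw [mul_comm]
      rw [h0, add_zero]
      rfl
    rw [hj, hG, ← hshift, ← mul_assoc]
    simp only [Units.val_mk0]
    rw [hχt, one_mul]

lemma GS_congr {m n : ℕ} [NeZero m] [NeZero n] (h : m = n) (t : ℤ) :
    GS m (t : ZMod m) = GS n (t : ZMod n) := by
  subst h; rfl

lemma prod_GS_eval (p : ℕ) [Fact p.Prime] (hp2 : p ≠ 2) (c : Fin 4 → ℤ)
    (hc : ∀ i, ¬ (p : ℤ) ∣ c i) (k : ℕ) : ∀ [NeZero (p ^ k)],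
    ∏ i, GS (p ^ k) (c i : ZMod (p ^ k)) = (jacobiSym (∏ i, c i) p : ℂ) ^ k * (p : ℂ) ^ (2 * k) := by
  have hp : p.Prime := Fact.out
  have hJ : (jacobiSym (∏ i, c i) p : ℂ) ^ 2 = 1 := by
    have h1 : Int.gcd (∏ i, c i) p = 1 := by
      rw [Int.gcd_comm, ← Int.isCoprime_iff_gcd_eq_one,
        (Nat.prime_iff_prime_int.mp hp).irreducible.coprime_iff_not_dvd,
        (Nat.prime_iff_prime_int.mp hp).dvd_finsetProd_iff]
      rintro ⟨i, _, hi⟩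
      exact hc i hi
    exact_mod_cast jacobiSym.sq_one h1
  induction k using Nat.twoStepInduction with
  | zero =>
    intro _
    simp only [pow_zero, mul_zero, mul_one]
    apply Finset.prod_eq_one
    intro i _
    unfold GS
    have : ∀ b : ZMod (p ^ 0), (ZMod.stdAddChar ((c i : ZMod (p ^ 0)) * b ^ 2) : ℂ) = 1 := by
      intro b
      have hss : Subsingleton (ZMod (p ^ 0)) := by rw [pow_zero]; infer_instance
      rw [Subsingleton.elim ((c i : ZMod (p ^ 0)) * b ^ 2) 0, AddChar.map_zero_eq_one]
    rw [Finset.sum_congr rfl fun b _ => this b]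
    rw [Finset.sum_const, Finset.card_univ, ZMod.card]
    simp
  | one =>
    obtain ⟨g, hg, hG⟩ := GS_prime p hp2
    intro _
    have h1 : ∀ i, GS (p ^ 1) (c i : ZMod (p ^ 1)) = (jacobiSym (c i) p : ℂ) * g := by
      intro i
      rw [← hG (c i) (hc i)]
      exact GS_congr (pow_one p) (c i)
    rw [Finset.prod_congr rfl fun i _ => h1 i, Finset.prod_mul_distrib, Finset.prod_const]
    simp only [Finset.card_univ, Fintype.card_fin, hg, Fin.prod_univ_four, jacobiSym.mul_left]
    push_cast
    ring
  | more k ih _ =>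
    intro _
    have hk : NeZero (p ^ k) := ⟨(pow_pos hp.pos k).ne'⟩
    rw [Finset.prod_congr rfl fun i _ => GS_rec p hp2 k (c i) (hc i), Finset.prod_mul_distrib,
      ih, Finset.prod_const, pow_add _ k 2, hJ]
    simp only [Finset.card_univ, Fintype.card_fin]
    ring

lemma SS_good (p : ℕ) [Fact p.Prime] (hp2 : p ≠ 2) (a : Fin 4 → ℤ)
    (ha : ¬ (p : ℤ) ∣ ∏ i, a i) (k : ℕ) [NeZero (p ^ k)] :
    SS (p ^ k) a = (Nat.totient (p ^ k) : ℂ) * ((jacobiSym (∏ i, a i) p : ℂ) ^ k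
      * (p : ℂ) ^ (2 * k)) := by
  have hp : p.Prime := Fact.out
  have hpi := Nat.prime_iff_prime_int.mp hp
  have hai : ∀ i, ¬ (p : ℤ) ∣ a i := fun i h => ha (h.trans (Finset.dvd_prod_of_mem a (Finset.mem_univ i)))
  rcases Nat.eq_zero_or_pos k with rfl | hk
  · have := prod_GS_eval p hp2 a hai 0
    unfold SS
    have hss : Subsingleton (ZMod (p ^ 0)) := by rw [pow_zero]; infer_instance
    have h1 : ∀ u : (ZMod (p ^ 0))ˣ, ∏ i, GS (p ^ 0) ((u : ZMod (p ^ 0)) * (a i : ZMod (p ^ 0)))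
        = (jacobiSym (∏ i, a i) p : ℂ) ^ 0 * (p : ℂ) ^ (2 * 0) := by
      intro u
      rw [← this]
      refine Finset.prod_congr rfl fun i _ => ?_
      congr 1
      exact Subsingleton.elim _ _
    rw [Finset.sum_congr rfl fun u _ => h1 u, Finset.sum_const, Finset.card_univ,
      ZMod.card_units_eq_totient, nsmul_eq_mul]
  · have h1 : ∀ u : (ZMod (p ^ k))ˣ, ∏ i, GS (p ^ k) ((u : ZMod (p ^ k)) * (a i : ZMod (p ^ k)))
        = (jacobiSym (∏ i, a i) p : ℂ) ^ k * (p : ℂ) ^ (2 * k) := by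
      intro u
      set v : ℕ := (u : ZMod (p ^ k)).val with hv
      have hcop : Nat.Coprime v p :=
        (Nat.coprime_pow_right_iff hk _ _).mp (ZMod.val_coe_unit_coprime u)
      have hvp : ¬ (p : ℤ) ∣ (v : ℤ) := by
        rw [Int.natCast_dvd_natCast, ← hp.coprime_iff_not_dvd]
        exact hcop.symm
      have h2 := prod_GS_eval p hp2 (fun i => (v : ℤ) * a i)
        (fun i h => (hpi.dvd_or_dvd h).elim hvp (hai i)) k
      have h3 : jacobiSym (∏ i, ((v : ℤ) * a i)) p = jacobiSym (∏ i, a i) p := by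
        have hgcd : Int.gcd ((v : ℤ) ^ 2) p = 1 := by
          rw [← Int.isCoprime_iff_gcd_eq_one]
          exact (Nat.isCoprime_iff_coprime.mpr hcop).pow_left
        rw [Finset.prod_mul_distrib, Finset.prod_const, jacobiSym.mul_left]
        simp only [Finset.card_univ, Fintype.card_fin]
        rw [show (v : ℤ) ^ 4 = ((v : ℤ) ^ 2) ^ 2 by ring, jacobiSym.sq_one' hgcd, one_mul]
      rw [h3] at h2
      rw [← h2]
      refine Finset.prod_congr rfl fun i _ => ?_
      congr 1
      push_cast
      rw [hv, ZMod.natCast_zmod_val]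
    unfold SS
    rw [Finset.sum_congr rfl fun u _ => h1 u, Finset.sum_const, Finset.card_univ,
      ZMod.card_units_eq_totient, nsmul_eq_mul]

/-! ### Part 7: assembly -/

/-- The summand of the singular series as an arithmetic function. -/
noncomputable def ffA (a : Fin 4 → ℤ) : ArithmeticFunction ℂ :=
  ⟨fun q => (1 / (q : ℂ) ^ 4) * Sqa a 0 q, by simp⟩

/-- `ffA` restricted to integers composed of bad primes. -/
noncomputable def fBad (a : Fin 4 → ℤ) : ArithmeticFunction ℂ :=
  ⟨fun q => if ∀ p : ℕ, p.Prime → p ∣ q → p ∣ 2 * (∏ i, a i).natAbs then ffA a q else 0, by simp⟩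

/-- The coefficients `χ(m)/m`. -/
noncomputable def chA (A : ℤ) : ArithmeticFunction ℂ :=
  ⟨fun m => (qch A m : ℂ) / (m : ℂ), by simp⟩

/-- The coefficients `μ(d)χ(d)/d²`. -/
noncomputable def muA (A : ℤ) : ArithmeticFunction ℂ :=
  ⟨fun d => (ArithmeticFunction.moebius d : ℂ) * (qch A d : ℂ) / (d : ℂ) ^ 2, by simp⟩

/-- The coefficients `χ(m)φ(m)/m²`. -/
noncomputable def vA (A : ℤ) : ArithmeticFunction ℂ :=
  ⟨fun m => (qch A m : ℂ) * (Nat.totient m : ℂ) / (m : ℂ) ^ 2, by simp⟩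

lemma vA_eq (A : ℤ) : vA A = muA A * chA A := by
  ext n
  rcases Nat.eq_zero_or_pos n with rfl | hn
  · simp
  have htot : ∀ n > 0, ∑ x ∈ n.divisorsAntidiagonal,
      ((ArithmeticFunction.moebius x.1 : ℤ) : ℂ) * ((x.2 : ℕ) : ℂ) = (Nat.totient n : ℂ) := by
    apply (ArithmeticFunction.sum_eq_iff_sum_mul_moebius_eq
      (f := fun n => (Nat.totient n : ℂ)) (g := fun n => (n : ℂ))).mp
    intro n _
    exact_mod_cast Nat.sum_totient n
  rw [ArithmeticFunction.mul_apply]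
  change (qch A n : ℂ) * (Nat.totient n : ℂ) / (n : ℂ) ^ 2 = ∑ x ∈ n.divisorsAntidiagonal,
    ((ArithmeticFunction.moebius x.1 : ℂ) * (qch A x.1 : ℂ) / (x.1 : ℂ) ^ 2)
      * ((qch A x.2 : ℂ) / (x.2 : ℂ))
  rw [← htot n hn, Finset.mul_sum, Finset.sum_div]
  refine Finset.sum_congr rfl fun x hx => ?_
  obtain ⟨hx1, hx2⟩ := Nat.mem_divisorsAntidiagonal.mp hx
  rw [← hx1, qch_mul]
  have h1 : (x.1 : ℂ) ≠ 0 := by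
    have : x.1 ≠ 0 := by rintro h; rw [h] at hx1; omega
    exact_mod_cast this
  have h2 : (x.2 : ℂ) ≠ 0 := by
    have : x.2 ≠ 0 := by rintro h; rw [h] at hx1; omega
    exact_mod_cast this
  push_cast
  field_simp

lemma Sqa_one (a : Fin 4 → ℤ) : Sqa a 0 1 = 1 := by
  simp [Sqa, eC]

lemma ffA_mult (a : Fin 4 → ℤ) : (ffA a).IsMultiplicative := by
  rw [ArithmeticFunction.IsMultiplicative.iff_ne_zero]
  constructor
  · change (1 / ((1 : ℕ) : ℂ) ^ 4) * Sqa a 0 1 = 1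
    rw [Sqa_one]; simp
  · intro m n hm hn h
    have : NeZero m := ⟨hm⟩
    have : NeZero n := ⟨hn⟩
    change (1 / ((m * n : ℕ) : ℂ) ^ 4) * Sqa a 0 (m * n)
      = ((1 / (m : ℂ) ^ 4) * Sqa a 0 m) * ((1 / (n : ℂ) ^ 4) * Sqa a 0 n)
    rw [Sqa_eq, Sqa_eq, Sqa_eq, SS_mul m n h]
    push_cast
    field_simp

lemma fBad_mult (a : Fin 4 → ℤ) : (fBad a).IsMultiplicative := by
  have hf := ffA_mult a
  rw [ArithmeticFunction.IsMultiplicative.iff_ne_zero]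
  constructor
  · change (if ∀ p : ℕ, p.Prime → p ∣ 1 → p ∣ 2 * (∏ i, a i).natAbs then ffA a 1 else 0) = 1
    rw [if_pos, hf.map_one]
    intro p hp h1
    exact absurd (Nat.dvd_one.mp h1) hp.ne_one
  · intro m n hm hn h
    change (if ∀ p : ℕ, p.Prime → p ∣ m * n → p ∣ 2 * (∏ i, a i).natAbs then ffA a (m * n) else 0)
      = (if ∀ p : ℕ, p.Prime → p ∣ m → p ∣ 2 * (∏ i, a i).natAbs then ffA a m else 0)
      * (if ∀ p : ℕ, p.Prime → p ∣ n → p ∣ 2 * (∏ i, a i).natAbs then ffA a n else 0)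
    have hiff : (∀ p : ℕ, p.Prime → p ∣ m * n → p ∣ 2 * (∏ i, a i).natAbs) ↔
        (∀ p : ℕ, p.Prime → p ∣ m → p ∣ 2 * (∏ i, a i).natAbs) ∧
        (∀ p : ℕ, p.Prime → p ∣ n → p ∣ 2 * (∏ i, a i).natAbs) := by
      constructor
      · intro H
        exact ⟨fun p hp hd => H p hp (hd.mul_right n), fun p hp hd => H p hp (hd.mul_left m)⟩
      · rintro ⟨H1, H2⟩ p hp hd
        exact (hp.dvd_mul.mp hd).elim (H1 p hp) (H2 p hp)
    rw [hf.map_mul_of_coprime h]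
    by_cases h1 : ∀ p : ℕ, p.Prime → p ∣ m → p ∣ 2 * (∏ i, a i).natAbs
    · by_cases h2 : ∀ p : ℕ, p.Prime → p ∣ n → p ∣ 2 * (∏ i, a i).natAbs
      · rw [if_pos h1, if_pos h2, if_pos (hiff.mpr ⟨h1, h2⟩)]
      · rw [if_neg h2, if_neg (fun H => h2 (hiff.mp H).2), mul_zero]
    · rw [if_neg h1, if_neg (fun H => h1 (hiff.mp H).1), zero_mul]

lemma qch_one (A : ℤ) : qch A 1 = 1 := by simp [qch]

lemma vA_mult (A : ℤ) : (vA A).IsMultiplicative := by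
  rw [ArithmeticFunction.IsMultiplicative.iff_ne_zero]
  constructor
  · change (qch A 1 : ℂ) * (Nat.totient 1 : ℂ) / ((1 : ℕ) : ℂ) ^ 2 = 1
    simp [qch_one]
  · intro m n hm hn h
    change (qch A (m * n) : ℂ) * (Nat.totient (m * n) : ℂ) / ((m * n : ℕ) : ℂ) ^ 2
      = ((qch A m : ℂ) * (Nat.totient m : ℂ) / (m : ℂ) ^ 2)
        * ((qch A n : ℂ) * (Nat.totient n : ℂ) / (n : ℂ) ^ 2)
    rw [qch_mul, Nat.totient_mul h]
    push_cast
    ring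

lemma qch_bad (A : ℤ) (p e : ℕ) (hp : p.Prime) (hpA : p ∣ 2 * A.natAbs) (hpe : p ∣ e) (he : e ≠ 0) :
    qch A e = 0 := by
  unfold qch
  split_ifs with ho
  · rw [jacobiSym.eq_zero_iff]
    refine ⟨he, fun h => ?_⟩
    have hpA' : p ∣ A.natAbs := by
      refine (hp.dvd_mul.mp hpA).resolve_left fun h2 => ?_
      have h2' := (Nat.prime_dvd_prime_iff_eq hp Nat.prime_two).mp h2
      rw [h2'] at hpe
      exact (Nat.not_even_iff_odd.mpr ho) (even_iff_two_dvd.mpr hpe)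
    have : (p : ℕ) ∣ Int.gcd A e :=
      Int.dvd_gcd (Int.natCast_dvd.mpr hpA') (Int.natCast_dvd_natCast.mpr hpe)
    rw [h] at this
    exact hp.ne_one (Nat.dvd_one.mp this)
  · rfl

lemma ffA_eq (a : Fin 4 → ℤ) : ffA a = fBad a * vA (∏ i, a i) := by
  rw [ArithmeticFunction.IsMultiplicative.eq_iff_eq_on_prime_powers _ (ffA_mult a) _
    ((fBad_mult a).mul (vA_mult _))]
  intro p k hp
  have hpf : Fact p.Prime := ⟨hp⟩
  have hpk : p ^ k ≠ 0 := (pow_pos hp.pos k).ne'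
  have hdiv : ∀ d, d ∣ p ^ k → d ≠ 1 → p ∣ d := by
    intro d hd hd1
    obtain ⟨i, _, rfl⟩ := (Nat.dvd_prime_pow hp).mp hd
    exact dvd_pow_self p (by rintro rfl; simp at hd1)
  rw [ArithmeticFunction.mul_apply]
  by_cases hbad : p ∣ 2 * (∏ i, a i).natAbs
  · rw [Finset.sum_eq_single (p ^ k, 1)]
    · rw [(vA_mult _).map_one, mul_one]
      change _ = if ∀ p' : ℕ, p'.Prime → p' ∣ p ^ k → p' ∣ 2 * (∏ i, a i).natAbs
        then ffA a (p ^ k) else 0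
      rw [if_pos]
      intro p' hp' hd
      rw [(Nat.prime_dvd_prime_iff_eq hp' hp).mp (hp'.dvd_of_dvd_pow hd)]
      exact hbad
    · rintro ⟨d, e⟩ hde hne
      obtain ⟨h1, h2⟩ := Nat.mem_divisorsAntidiagonal.mp hde
      simp only at h1
      have he1 : e ≠ 1 := by
        rintro rfl
        apply hne
        rw [← h1, mul_one]
      have hpe := hdiv e ⟨d, by rw [← h1]; ring⟩ he1
      have he0 : e ≠ 0 := by rintro rfl; rw [mul_zero] at h1; exact hpk h1.symm
      have : vA (∏ i, a i) e = 0 := by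
        change (qch (∏ i, a i) e : ℂ) * (Nat.totient e : ℂ) / (e : ℂ) ^ 2 = 0
        rw [qch_bad _ p e hp hbad hpe he0]
        simp
      simp only [this, mul_zero]
    · intro h
      exact absurd (Nat.mem_divisorsAntidiagonal.mpr ⟨by simp, hpk⟩) h
  · have hp2 : p ≠ 2 := by rintro rfl; exact hbad (dvd_mul_right _ _)
    have hpA : ¬ (p : ℤ) ∣ ∏ i, a i := by
      intro h
      exact hbad ((Int.natCast_dvd.mp h).mul_left 2)
    rw [Finset.sum_eq_single (1, p ^ k)]
    · rw [(fBad_mult _).map_one, one_mul]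
      change (1 / ((p ^ k : ℕ) : ℂ) ^ 4) * Sqa a 0 (p ^ k)
        = (qch (∏ i, a i) (p ^ k) : ℂ) * (Nat.totient (p ^ k) : ℂ) / ((p ^ k : ℕ) : ℂ) ^ 2
      have hz : NeZero (p ^ k) := ⟨hpk⟩
      have hodd : Odd (p ^ k) := (hp.odd_of_ne_two hp2).pow
      have hpC : (p : ℂ) ≠ 0 := by exact_mod_cast hp.ne_zero
      rw [Sqa_eq, SS_good p hp2 a hpA k, qch, if_pos hodd, jacobiSym.pow_right]
      push_cast
      field_simp
      ring
    · rintro ⟨d, e⟩ hde hne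
      obtain ⟨h1, h2⟩ := Nat.mem_divisorsAntidiagonal.mp hde
      simp only at h1
      have hd1 : d ≠ 1 := by
        rintro rfl
        apply hne
        rw [← h1, one_mul]
      have hpd := hdiv d ⟨e, h1.symm⟩ hd1
      have : fBad a d = 0 := by
        change (if ∀ p' : ℕ, p'.Prime → p' ∣ d → p' ∣ 2 * (∏ i, a i).natAbs
          then ffA a d else 0) = 0
        rw [if_neg]
        intro H
        exact hbad (H p hp hpd)
      simp only [this, zero_mul]
    · intro h
      exact absurd (Nat.mem_divisorsAntidiagonal.mpr ⟨by simp, hpk⟩) h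

lemma ffA_bound (a : Fin 4 → ℤ) (ha : ∀ i, a i ≠ 0) (q : ℕ) (hq : 0 < q) (δ : ℝ) (hδ : 0 < δ)
    (hδ1 : δ ≤ 1) :
    ‖ffA a q‖ ≤ 4 * ((Delta4 a : ℝ) ^ ((1 : ℝ) / 4) * ((∏ i, a i).natAbs : ℝ) ^ (δ / 2))
      * (q : ℝ) ^ (-δ) := by
  have hz : NeZero q := ⟨hq.ne'⟩
  have hq0 : (0 : ℝ) < q := by exact_mod_cast hq
  change ‖(1 / (q : ℂ) ^ 4) * Sqa a 0 q‖ ≤ _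
  rw [Sqa_eq, norm_mul, norm_div, norm_one, norm_pow, Complex.norm_natCast]
  calc 1 / (q : ℝ) ^ 4 * ‖SS q a‖
      ≤ 1 / (q : ℝ) ^ 4 * (4 * (q : ℝ) ^ 3 * Real.sqrt ((∏ i, Int.gcd (a i) q : ℕ) : ℝ)) := by
        gcongr
        exact SS_bound a ha q
    _ = 4 * ((q : ℝ)⁻¹ * Real.sqrt ((∏ i, Int.gcd (a i) q : ℕ) : ℝ)) := by
        field_simp
    _ ≤ 4 * ((Delta4 a : ℝ) ^ ((1 : ℝ) / 4) * ((∏ i, a i).natAbs : ℝ) ^ (δ / 2) * (q : ℝ) ^ (-δ)) := by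
        exact mul_le_mul_of_nonneg_left (gcd_interp a ha q hq δ hδ hδ1) (by norm_num)
    _ = _ := by ring

lemma fBad_sum (a : Fin 4 → ℤ) (ha : ∀ i, a i ≠ 0) (δ : ℝ) (hδ : 0 < δ) (hδ1 : δ ≤ 1) :
    Summable (fun n => ‖fBad a n‖) ∧ ∑' n, ‖fBad a n‖
      ≤ 4 * ((Delta4 a : ℝ) ^ ((1 : ℝ) / 4) * ((∏ i, a i).natAbs : ℝ) ^ (δ / 2))
        * ((1 - (2 : ℝ) ^ (-δ))⁻¹) ^ (2 * (∏ i, a i).natAbs).primeFactors.card := by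
  set s := (2 * (∏ i, a i).natAbs).primeFactors with hs
  have hA0 : 2 * (∏ i, a i).natAbs ≠ 0 := by
    have := Int.natAbs_pos.mpr (Finset.prod_ne_zero_iff.mpr fun i (_ : i ∈ Finset.univ) => ha i)
    omega
  obtain ⟨h1, h2⟩ := factored_sum δ hδ s (fun p hp => Nat.prime_of_mem_primeFactors hp)
  set K : ℝ := 4 * ((Delta4 a : ℝ) ^ ((1 : ℝ) / 4) * ((∏ i, a i).natAbs : ℝ) ^ (δ / 2)) with hK
  have hK0 : 0 ≤ K := by positivity
  have hle : ∀ n, ‖fBad a n‖ ≤ K * (if n ∈ Nat.factoredNumbers s then (n : ℝ) ^ (-δ) else 0) := by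
    intro n
    rcases Nat.eq_zero_or_pos n with rfl | hn
    · rw [ArithmeticFunction.map_zero, norm_zero]
      split_ifs <;> positivity
    change ‖if ∀ p : ℕ, p.Prime → p ∣ n → p ∣ 2 * (∏ i, a i).natAbs then ffA a n else 0‖ ≤ _
    by_cases h : ∀ p : ℕ, p.Prime → p ∣ n → p ∣ 2 * (∏ i, a i).natAbs
    · have hmem : n ∈ Nat.factoredNumbers s := by
        rw [Nat.mem_factoredNumbers']
        intro p hp hd
        exact Nat.mem_primeFactors.mpr ⟨hp, h p hp hd, hA0⟩
      rw [if_pos h, if_pos hmem]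
      exact ffA_bound a ha n hn δ hδ hδ1
    · rw [if_neg h, norm_zero]
      split_ifs <;> positivity
  have hsum : Summable (fun n => ‖fBad a n‖) :=
    Summable.of_nonneg_of_le (fun _ => norm_nonneg _) hle (h1.mul_left K)
  refine ⟨hsum, ?_⟩
  calc _ ≤ ∑' n : ℕ, K * (if n ∈ Nat.factoredNumbers s then (n : ℝ) ^ (-δ) else 0) :=
        hsum.tsum_le_tsum hle (h1.mul_left K)
    _ = K * ∑' n : ℕ, (if n ∈ Nat.factoredNumbers s then (n : ℝ) ^ (-δ) else 0) := tsum_mul_left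
    _ ≤ _ := by gcongr

lemma muA_sum (A : ℤ) : Summable (fun n => ‖muA A n‖) ∧
    ∑' n, ‖muA A n‖ ≤ ∑' n : ℕ, 1 / (n : ℝ) ^ 2 := by
  have h1 : Summable (fun n : ℕ => 1 / (n : ℝ) ^ 2) := Real.summable_one_div_nat_pow.mpr (by norm_num)
  have hle : ∀ n, ‖muA A n‖ ≤ 1 / (n : ℝ) ^ 2 := by
    intro n
    change ‖(ArithmeticFunction.moebius n : ℂ) * (qch A n : ℂ) / (n : ℂ) ^ 2‖ ≤ _
    rw [norm_div, norm_mul, norm_pow, Complex.norm_natCast, Complex.norm_intCast,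
      Complex.norm_intCast]
    gcongr
    have e1 : |(ArithmeticFunction.moebius n : ℝ)| ≤ 1 := by
      exact_mod_cast ArithmeticFunction.abs_moebius_le_one
    have e2 : |(qch A n : ℝ)| ≤ 1 := by exact_mod_cast qch_abs_le A n
    exact mul_le_one₀ e1 (abs_nonneg _) e2
  have hsum : Summable (fun n => ‖muA A n‖) :=
    Summable.of_nonneg_of_le (fun _ => norm_nonneg _) hle h1
  exact ⟨hsum, hsum.tsum_le_tsum hle h1⟩

/-- Lemma 4.16: existence and bound `𝔊_a ≪ |A|^ε Δ^{1/4}` for the singular series. -/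
theorem statement_15 (ε : ℝ) (hε : 0 < ε) :
    ∃ C : ℝ, 0 < C ∧
      ∀ a : Fin 4 → ℤ, (∀ i, a i ≠ 0) → ¬ IsSquare (∏ i, a i) →
        ∃ G : ℂ, Filter.Tendsto (singularPartial a) Filter.atTop (nhds G) ∧
          ‖G‖ ≤ C * (((∏ i, a i).natAbs : ℝ)) ^ ε * (Delta4 a : ℝ) ^ ((1 : ℝ) / 4) := by
  set δ : ℝ := min 1 ε with hδdef
  have hδ : 0 < δ := lt_min one_pos hε
  have hδ1 : δ ≤ 1 := min_le_left _ _
  have hδε : δ ≤ ε := min_le_right _ _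
  have h21 : (2 : ℝ) ^ (-δ) < 1 := Real.rpow_lt_one_of_one_lt_of_neg (by norm_num) (by linarith)
  have h20 : (0 : ℝ) < (2 : ℝ) ^ (-δ) := by positivity
  have hη : 0 < ε / 4 := by linarith
  obtain ⟨K1, hK1, hlog⟩ := log_bound (ε / 4) hη
  obtain ⟨K2, hK2, hom⟩ := omega_bound ((1 - (2 : ℝ) ^ (-δ))⁻¹)
    (one_le_inv₀ (by linarith) |>.mpr (by linarith)) (ε / 4) hη
  set Z : ℝ := ∑' n : ℕ, 1 / (n : ℝ) ^ 2 with hZ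
  have hZ0 : 0 ≤ Z := tsum_nonneg fun n => by positivity
  refine ⟨4 * (K2 * (2 : ℝ) ^ (ε / 4)) * ((Z + 1) * K1), by positivity, ?_⟩
  intro a ha hsq
  set A : ℤ := ∏ i, a i with hA
  have hA0 : A ≠ 0 := Finset.prod_ne_zero_iff.mpr fun i _ => ha i
  have hAn : A.natAbs ≠ 0 := Int.natAbs_ne_zero.mpr hA0
  have hA1 : (1 : ℝ) ≤ A.natAbs := by exact_mod_cast Nat.one_le_iff_ne_zero.mpr hAn
  obtain ⟨⟨L, hL⟩, hB⟩ := qch_series A hA0 hsq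
  obtain ⟨hmu1, hmu2⟩ := muA_sum A
  obtain ⟨hf1, hf2⟩ := fBad_sum a ha δ hδ hδ1
  obtain ⟨⟨L1, hL1⟩, hB1⟩ := conv_partial (muA A) (chA A) hmu1 _ hB L hL
  rw [← vA_eq] at hL1 hB1
  obtain ⟨⟨G, hG⟩, hB2⟩ := conv_partial (fBad a) (vA A) hf1 _ hB1 L1 hL1
  rw [← ffA_eq] at hG hB2
  have hpart : ∀ T, singularPartial a T = ∑ n ∈ Finset.Ioc 0 T, ffA a n := by
    intro T
    rfl
  refine ⟨G, hG.congr fun T => (hpart T).symm, ?_⟩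
  refine (le_of_tendsto hG.norm (Filter.Eventually.of_forall hB2)).trans ?_
  have hlogA := hlog A.natAbs hAn
  have hlog0 : 0 ≤ 3 + Real.log ((4 * A.natAbs : ℕ) : ℝ) := (norm_nonneg _).trans (hB 0)
  have homA := hom (2 * A.natAbs) (by omega)
  set D : ℝ := (Delta4 a : ℝ) ^ ((1 : ℝ) / 4) with hD
  have hD0 : 0 ≤ D := by positivity
  set x : ℝ := (A.natAbs : ℝ) with hx
  have hx0 : 0 < x := by linarith
  have e2 : (∑' n, ‖muA A n‖) * (3 + Real.log ((4 * A.natAbs : ℕ) : ℝ))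
      ≤ (Z + 1) * (K1 * x ^ (ε / 4)) :=
    mul_le_mul (hmu2.trans (by linarith)) hlogA hlog0 (by positivity)
  have e1 : ∑' n, ‖fBad a n‖ ≤ 4 * (D * x ^ (ε / 2)) * (K2 * ((2 : ℝ) ^ (ε / 4) * x ^ (ε / 4))) := by
    refine hf2.trans ?_
    apply mul_le_mul
    · have : x ^ (δ / 2) ≤ x ^ (ε / 2) := Real.rpow_le_rpow_of_exponent_le hA1 (by linarith)
      gcongr
    · refine homA.trans (le_of_eq ?_)
      push_cast
      rw [Real.mul_rpow (by norm_num) hx0.le]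
    · have : 0 ≤ (1 - (2 : ℝ) ^ (-δ))⁻¹ := inv_nonneg.mpr (by linarith)
      positivity
    · positivity
  calc _ ≤ (4 * (D * x ^ (ε / 2)) * (K2 * ((2 : ℝ) ^ (ε / 4) * x ^ (ε / 4))))
        * ((Z + 1) * (K1 * x ^ (ε / 4))) := by
        refine mul_le_mul e1 e2 ?_ (by positivity)
        exact mul_nonneg (tsum_nonneg fun _ => norm_nonneg _) hlog0
    _ = 4 * (K2 * (2 : ℝ) ^ (ε / 4)) * ((Z + 1) * K1)
        * (x ^ (ε / 2) * x ^ (ε / 4) * x ^ (ε / 4)) * D := by ring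
    _ = _ := by
        rw [← Real.rpow_add hx0, ← Real.rpow_add hx0]
        congr 3
        ring
end
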